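/- Let n≥1 and let τ lie in the upper half-plane with p=e^{iπτ}. Then, as z₁,…,z_{2n} tend to 0 through pairwise distinct values, lim P_n^{(2)}(z₁,…,z_{2n};τ) / ∏_{1≤i<j≤2n}(z_i−z_j) = ((2iC₂)ⁿ · D₂^{n(2n−1)} / ∏_{j=1}^{2n}(j−1)!) · det_{1≤i,j≤n}(L_{i+j−2}^{(2)}), where C₂=(−p;−p)_∞/((p²;p²)_∞²(−p³;−p³)_∞), D₂=π(p³;p⁶)_∞², and for j≥0, L_j^{(2)} = Σ_{k=1}^∞ ((k+1)/3)·(p^{k−1}/(1+p^{2k−1}))·(2k−1)^{2j+1}. -/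

import Mathlib

open Complex BigOperators Finset

noncomputable section

def qpoch (a p : ℂ) : ℂ := ∏' j : ℕ, (1 - a * p ^ j)

def theta (x p : ℂ) : ℂ := qpoch x p * qpoch (p / x) p

def pf {m : ℕ} (A : Matrix (Fin (2 * m)) (Fin (2 * m)) ℂ) : ℂ :=
  (1 / (2 ^ m * (Nat.factorial m) : ℂ)) *
    ∑ σ : Equiv.Perm (Fin (2 * m)), ((Equiv.Perm.sign σ : ℤ) : ℂ) *
      ∏ j : Fin m, A (σ ⟨2 * (j : ℕ), by have := j.isLt; omega⟩)
        (σ ⟨2 * (j : ℕ) + 1, by have := j.isLt; omega⟩)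

def pPow (τ lam : ℂ) : ℂ := Complex.exp (Real.pi * Complex.I * τ * lam)

def xOf (z : ℂ) : ℂ := Complex.exp (Real.pi * Complex.I * z)

def leg (k : ℤ) : ℤ := if k % 3 = 0 then 0 else if k % 3 = 1 then 1 else -1

def P2 (n : ℕ) (τ : ℂ) (z : Fin (2 * n) → ℂ) : ℂ :=
  let p : ℂ → ℂ := fun lam => pPow τ lam
  let x : Fin (2 * n) → ℂ := fun j => xOf (z j)
  (∏ i, ∏ j, if i < j then
      theta (p 3 * ((x i) ^ 6 / (x j) ^ 6)) (p 6) else 1) *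
  pf (fun i j => x j / x i *
      theta ((x i) ^ 2 / (x j) ^ 2) (p 2) * theta (p 1 * ((x i) ^ 2 / (x j) ^ 2)) (p 2) *
      theta (-(p 1 * ((x i) ^ 2 / (x j) ^ 2))) (p 2) /
      theta (p 3 * ((x i) ^ 6 / (x j) ^ 6)) (p 6))

def C2 (p : ℂ) : ℂ := qpoch (-p) (-p) / (qpoch (p ^ 2) (p ^ 2) ^ 2 * qpoch (-p ^ 3) (-p ^ 3))

def D2 (p : ℂ) : ℂ := Real.pi * qpoch (p ^ 3) (p ^ 6) ^ 2

/-- The Lambert-type series `L_j^{(2)}`. -/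
def L2 (p : ℂ) (j : ℕ) : ℂ :=
  ∑' k : ℕ, (leg ((k : ℤ) + 2) : ℂ) *
    (p ^ k / (1 + p ^ (2 * k + 1))) * (2 * (k : ℂ) + 1) ^ (2 * j + 1)

/-! ### Infinite `q`-products -/

lemma summable_qpoch {q : ℂ} (hq : ‖q‖ < 1) (y : ℂ) : Summable fun j : ℕ => ‖-(y * q ^ j)‖ := by
  simp only [norm_neg, norm_mul, norm_pow]
  exact (summable_geometric_of_lt_one (norm_nonneg _) hq).mul_left _

lemma multipliable_qpoch {q : ℂ} (hq : ‖q‖ < 1) (y : ℂ) :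
    Multipliable fun j : ℕ => (1 - y * q ^ j) := by
  simpa [sub_eq_add_neg] using multipliable_one_add_of_summable (summable_qpoch hq y)

lemma qpoch_ne_zero_of_forall {q : ℂ} (hq : ‖q‖ < 1) {y : ℂ} (h : ∀ j : ℕ, y * q ^ j ≠ 1) :
    qpoch y q ≠ 0 := by
  have := tprod_one_add_ne_zero_of_summable (f := fun j : ℕ => -(y * q ^ j))
    (fun j => by rw [← sub_eq_add_neg, sub_ne_zero]; exact (h j).symm) (summable_qpoch hq y)
  simpa [qpoch, sub_eq_add_neg] using this

lemma qpoch_ne_zero {q : ℂ} (hq : ‖q‖ < 1) {y : ℂ} (hy : ‖y‖ < 1) : qpoch y q ≠ 0 := by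
  refine qpoch_ne_zero_of_forall hq fun j h => ?_
  have h1 : ‖y * q ^ j‖ < 1 := by
    rw [norm_mul, norm_pow]
    calc ‖y‖ * ‖q‖ ^ j ≤ ‖y‖ * 1 := by
          gcongr; exact pow_le_one₀ (norm_nonneg _) hq.le
      _ < 1 := by simpa using hy
  rw [h] at h1
  simp at h1

/-- The Taylor coefficients of `y ↦ (y; q)_∞`. -/
def eulerCoeff (q : ℂ) : ℕ → ℂ
  | 0 => 1
  | m + 1 => -q ^ m / (1 - q ^ (m + 1)) * eulerCoeff q m

lemma one_sub_pow_ne_zero {q : ℂ} (hq : ‖q‖ < 1) (m : ℕ) : 1 - q ^ (m + 1) ≠ 0 := by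
  intro h
  have h1 : ‖q ^ (m + 1)‖ < 1 := by
    rw [norm_pow]; exact pow_lt_one₀ (norm_nonneg _) hq (by omega)
  rw [← sub_eq_zero.1 h] at h1
  simp at h1

lemma eulerCoeff_succ {q : ℂ} (hq : ‖q‖ < 1) (m : ℕ) :
    (1 - q ^ (m + 1)) * eulerCoeff q (m + 1) = -q ^ m * eulerCoeff q m := by
  have := one_sub_pow_ne_zero hq m
  rw [eulerCoeff]; field_simp

lemma summable_eulerCoeff {q : ℂ} (hq : ‖q‖ < 1) (y : ℂ) :
    Summable fun m : ℕ => ‖eulerCoeff q m * y ^ m‖ := by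
  have h0 : Filter.Tendsto (fun m : ℕ => ‖-q ^ m / (1 - q ^ (m + 1)) * y‖) Filter.atTop (nhds 0) := by
    have h1 := tendsto_pow_atTop_nhds_zero_of_norm_lt_one hq
    have h2 := (Filter.tendsto_add_atTop_iff_nat 1).2 h1
    have := (((h1.neg).div (h2.const_sub 1) (by simp)).mul_const y).norm
    simpa using this
  refine summable_of_ratio_norm_eventually_le (r := 1 / 2) (by norm_num) ?_
  filter_upwards [h0.eventually_le_const (show (0 : ℝ) < 1 / 2 by norm_num)] with m hm
  rw [norm_norm, norm_norm, eulerCoeff, pow_succ']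
  calc _ = ‖-q ^ m / (1 - q ^ (m + 1)) * y‖ * ‖eulerCoeff q m * y ^ m‖ := by
        rw [← norm_mul]; ring_nf
    _ ≤ _ := by gcongr

lemma continuous_eulerSeries {q : ℂ} (hq : ‖q‖ < 1) :
    Continuous fun y : ℂ => ∑' m : ℕ, eulerCoeff q m * y ^ m := by
  rw [continuous_iff_continuousAt]
  intro y
  have hc : ContinuousOn (fun y : ℂ => ∑' m : ℕ, eulerCoeff q m * y ^ m)
      (Metric.ball 0 (‖y‖ + 1)) := by
    refine continuousOn_tsum (u := fun m => ‖eulerCoeff q m * ((‖y‖ + 1 : ℝ) : ℂ) ^ m‖)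
      (fun m => by fun_prop) (summable_eulerCoeff hq _) ?_
    intro m x hx
    have hx' : ‖x‖ ≤ ‖y‖ + 1 := by simpa using (Metric.mem_ball.1 hx).le
    rw [norm_mul, norm_mul, norm_pow, norm_pow, Complex.norm_real, Real.norm_of_nonneg (by positivity)]
    gcongr
  exact hc.continuousAt (Metric.isOpen_ball.mem_nhds (by simp))

lemma eulerSeries_funcEq {q : ℂ} (hq : ‖q‖ < 1) (y : ℂ) :
    ∑' m : ℕ, eulerCoeff q m * y ^ m = (1 - y) * ∑' m : ℕ, eulerCoeff q m * (y * q) ^ m := by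
  have s1 : Summable fun m : ℕ => eulerCoeff q m * y ^ m := (summable_eulerCoeff hq y).of_norm
  have s2 : Summable fun m : ℕ => eulerCoeff q m * (y * q) ^ m :=
    (summable_eulerCoeff hq (y * q)).of_norm
  have e1 := s1.tsum_eq_zero_add
  have e2 := s2.tsum_eq_zero_add
  have s1' := (summable_nat_add_iff 1).2 s1
  have s2' := (summable_nat_add_iff 1).2 s2
  have key : (∑' m : ℕ, eulerCoeff q (m + 1) * y ^ (m + 1)) -
      ∑' m : ℕ, eulerCoeff q (m + 1) * (y * q) ^ (m + 1) =
      -y * ∑' m : ℕ, eulerCoeff q m * (y * q) ^ m := by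
    rw [← s1'.tsum_sub s2', ← tsum_mul_left]
    refine tsum_congr fun m => ?_
    have := eulerCoeff_succ hq m
    rw [mul_pow, mul_pow]
    linear_combination y ^ (m + 1) * this
  have e3 : (∑' m : ℕ, eulerCoeff q m * y ^ m) - ∑' m : ℕ, eulerCoeff q m * (y * q) ^ m =
      -y * ∑' m : ℕ, eulerCoeff q m * (y * q) ^ m := by
    rw [← key, e1, e2]; simp
  linear_combination e3

lemma qpoch_eq_tsum {q : ℂ} (hq : ‖q‖ < 1) (y : ℂ) :
    qpoch y q = ∑' m : ℕ, eulerCoeff q m * y ^ m := by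
  have h1 : ∀ N : ℕ, ∑' m : ℕ, eulerCoeff q m * y ^ m =
      (∏ j ∈ Finset.range N, (1 - y * q ^ j)) * ∑' m : ℕ, eulerCoeff q m * (y * q ^ N) ^ m := by
    intro N
    induction N with
    | zero => simp
    | succ N ih =>
      rw [ih, eulerSeries_funcEq hq (y * q ^ N), Finset.prod_range_succ, pow_succ]
      ring_nf
  have h2 := (multipliable_qpoch hq y).hasProd.tendsto_prod_nat
  have h3 : Filter.Tendsto (fun N : ℕ => ∑' m : ℕ, eulerCoeff q m * (y * q ^ N) ^ m) Filter.atTop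
      (nhds 1) := by
    have h4 : Filter.Tendsto (fun N : ℕ => y * q ^ N) Filter.atTop (nhds 0) := by
      simpa using (tendsto_pow_atTop_nhds_zero_of_norm_lt_one hq).const_mul y
    have h5 := ((continuous_eulerSeries hq).tendsto 0).comp h4
    have h6 : ∑' m : ℕ, eulerCoeff q m * (0 : ℂ) ^ m = 1 := by
      rw [tsum_eq_single 0 (by intro m hm; simp [hm])]
      simp [eulerCoeff]
    rwa [h6] at h5
  have h7 := h2.mul h3
  rw [mul_one] at h7
  refine tendsto_nhds_unique h7 ?_
  refine tendsto_const_nhds.congr fun N => ?_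
  exact h1 N

lemma qpoch_succ {q : ℂ} (hq : ‖q‖ < 1) (y : ℂ) : qpoch y q = (1 - y) * qpoch (y * q) q := by
  rw [qpoch_eq_tsum hq, qpoch_eq_tsum hq, eulerSeries_funcEq hq]

lemma continuous_qpoch {q : ℂ} (hq : ‖q‖ < 1) : Continuous fun y => qpoch y q := by
  simpa only [qpoch_eq_tsum hq] using continuous_eulerSeries hq

/-! ### Laurent series -/

lemma laurent_conv (d : ℤ) {a b : ℤ → ℂ} {X : ℂ} (hX : X ≠ 0)
    (ha : Summable fun m => ‖a m * X ^ m‖) (hb : Summable fun n => ‖b n * X ^ (d * n)‖) :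
    HasSum (fun j => (∑' n, a (j - d * n) * b n) * X ^ j)
      ((∑' m, a m * X ^ m) * ∑' n, b n * X ^ (d * n)) := by
  have hs := summable_mul_of_summable_norm ha hb
  have hp : HasSum (fun x : ℤ × ℤ => a x.1 * X ^ x.1 * (b x.2 * X ^ (d * x.2)))
      ((∑' m, a m * X ^ m) * ∑' n, b n * X ^ (d * n)) := by
    rw [tsum_mul_tsum_of_summable_norm ha hb]; exact hs.hasSum
  let e : ℤ × ℤ ≃ ℤ × ℤ :=
    { toFun := fun x => (x.1 - d * x.2, x.2)
      invFun := fun x => (x.1 + d * x.2, x.2)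
      left_inv := fun x => by simp
      right_inv := fun x => by simp }
  have hq : HasSum (fun x : ℤ × ℤ => a (x.1 - d * x.2) * b x.2 * X ^ x.1)
      ((∑' m, a m * X ^ m) * ∑' n, b n * X ^ (d * n)) := by
    refine ((e.hasSum_iff).2 hp).congr_fun fun x => ?_
    simp only [Function.comp, e, Equiv.coe_fn_mk]
    rw [show X ^ x.1 = X ^ (x.1 - d * x.2) * X ^ (d * x.2) by
      rw [← zpow_add₀ hX]; congr 1; ring]
    ring
  refine hq.prod_fiberwise fun j => ?_
  rw [← tsum_mul_right]
  exact (hq.summable.prod_factor j).hasSum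

lemma laurent_conv_summable (d : ℤ) {a b : ℤ → ℂ} {X : ℂ} (hX : X ≠ 0)
    (ha : Summable fun m => ‖a m * X ^ m‖) (hb : Summable fun n => ‖b n * X ^ (d * n)‖) (j : ℤ) :
    Summable fun n => a (j - d * n) * b n := by
  have hs := summable_mul_of_summable_norm ha hb
  have := hs.comp_injective (i := fun n : ℤ => (j - d * n, n)) (fun x y h => (Prod.ext_iff.1 h).2)
  refine (this.mul_right (X ^ (-j))).congr fun n => ?_
  simp only [Function.comp]
  rw [show X ^ (-j) = (X ^ (j - d * n) * X ^ (d * n))⁻¹ by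
    rw [← zpow_add₀ hX, ← zpow_neg]; congr 1; ring]
  have h1 := zpow_ne_zero (j - d * n) hX
  have h2 := zpow_ne_zero (d * n) hX
  field_simp

/-- `eulerCoeff`, extended by zero to negative indices. -/
def eulerCoeffInt (q : ℂ) (m : ℤ) : ℂ := if 0 ≤ m then eulerCoeff q m.toNat else 0

lemma eulerCoeffInt_rec {q : ℂ} (hq : ‖q‖ < 1) (m : ℤ) :
    (1 - q ^ m) * eulerCoeffInt q m = -q ^ (m - 1) * eulerCoeffInt q (m - 1) := by
  rcases lt_trichotomy m 0 with h | h | h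
  · rw [eulerCoeffInt, eulerCoeffInt, if_neg (by omega), if_neg (by omega)]; simp
  · subst h; simp [eulerCoeffInt]
  · obtain ⟨k, rfl⟩ : ∃ k : ℕ, m = (k : ℤ) + 1 := ⟨(m - 1).toNat, by omega⟩
    have := eulerCoeff_succ hq k
    rw [eulerCoeffInt, eulerCoeffInt, if_pos (by omega), if_pos (by omega)]
    rw [show ((k : ℤ) + 1).toNat = k + 1 by omega, show ((k : ℤ) + 1 - 1).toNat = k by omega]
    rw [show (k : ℤ) + 1 - 1 = k by ring, show (k : ℤ) + 1 = ((k + 1 : ℕ) : ℤ) by simp]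
    simpa only [zpow_natCast] using this

lemma hasSum_eulerCoeffInt {q : ℂ} (hq : ‖q‖ < 1) (y : ℂ) :
    HasSum (fun m : ℤ => eulerCoeffInt q m * y ^ m) (qpoch y q) := by
  rw [← (Nat.cast_injective (R := ℤ)).hasSum_iff]
  · rw [qpoch_eq_tsum hq]
    have := (summable_eulerCoeff hq y).of_norm.hasSum
    simpa [Function.comp_def, eulerCoeffInt] using this
  · intro m hm
    have : ¬ 0 ≤ m := fun h => hm ⟨m.toNat, by simp [h]⟩
    simp [eulerCoeffInt, this]

/-- The unnormalised Laurent coefficients of the theta function with nome `q`. -/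
def thetaCoeff (q : ℂ) (n : ℤ) : ℂ := ∑' m : ℤ, eulerCoeffInt q (n + m) * (eulerCoeffInt q m * q ^ m)

lemma hasSum_thetaCoeff {q : ℂ} (hq : ‖q‖ < 1) {y : ℂ} (hy : y ≠ 0) :
    HasSum (fun n : ℤ => thetaCoeff q n * y ^ n) (theta y q) := by
  have h1 := hasSum_eulerCoeffInt hq y
  have h2 : HasSum (fun m : ℤ => eulerCoeffInt q m * q ^ m * y ^ (-1 * m)) (qpoch (q / y) q) := by
    refine (hasSum_eulerCoeffInt hq (q / y)).congr_fun fun m => ?_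
    rw [div_zpow, neg_one_mul, zpow_neg]; ring
  have := laurent_conv (-1) hy h1.summable.norm h2.summable.norm
  rw [h1.tsum_eq, h2.tsum_eq] at this
  simpa [thetaCoeff, theta] using this

lemma thetaCoeff_rec {q : ℂ} (hq0 : q ≠ 0) (hq : ‖q‖ < 1) (n : ℤ) :
    thetaCoeff q (n + 1) + q ^ n * thetaCoeff q n =
      thetaCoeff q (n + 2) + q ^ (n + 1) * thetaCoeff q (n + 1) := by
  have h1 : Summable fun m : ℤ => eulerCoeffInt q m * 1 ^ m :=
    (hasSum_eulerCoeffInt hq 1).summable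
  have h2 : Summable fun m : ℤ => eulerCoeffInt q m * q ^ m * 1 ^ (-1 * m) := by
    simpa using (hasSum_eulerCoeffInt hq q).summable
  have h3 : Summable fun m : ℤ => eulerCoeffInt q m * 1 ^ (-1 * m) := by simpa using h1
  have sA (n : ℤ) : Summable fun m : ℤ => eulerCoeffInt q (n + m) * (eulerCoeffInt q m * q ^ m) := by
    simpa using laurent_conv_summable (-1) one_ne_zero h1.norm h2.norm n
  have sB (n : ℤ) : Summable fun m : ℤ => eulerCoeffInt q (n + m) * eulerCoeffInt q m := by
    simpa using laurent_conv_summable (-1) one_ne_zero h1.norm h3.norm n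
  have e1 : q ^ n * thetaCoeff q n =
      -(∑' m, eulerCoeffInt q (n + 1 + m) * eulerCoeffInt q m) +
        q ^ (n + 1) * thetaCoeff q (n + 1) := by
    rw [thetaCoeff, thetaCoeff, ← tsum_mul_left, ← tsum_mul_left, ← tsum_neg,
      ← (sB _).neg.tsum_add ((sA _).mul_left _)]
    refine tsum_congr fun m => ?_
    have := eulerCoeffInt_rec hq (n + 1 + m)
    rw [show n + 1 + m - 1 = n + m by ring] at this
    have e2 : q ^ (n + 1 + m) = q ^ (n + 1) * q ^ m := zpow_add₀ hq0 _ _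
    have e3 : q ^ (n + m) = q ^ n * q ^ m := zpow_add₀ hq0 _ _
    rw [e2, e3] at this
    linear_combination eulerCoeffInt q m * this
  have e2 : thetaCoeff q (n + 2) =
      thetaCoeff q (n + 1) - ∑' m, eulerCoeffInt q (n + 1 + m) * eulerCoeffInt q m := by
    conv_rhs => rw [thetaCoeff, ← (sA _).tsum_sub (sB _)]
    conv_lhs => rw [thetaCoeff, ← (Equiv.subRight (1 : ℤ)).tsum_eq]
    refine tsum_congr fun m => ?_
    have := eulerCoeffInt_rec hq m
    simp only [Equiv.subRight_apply]
    rw [show n + 2 + (m - 1) = n + 1 + m by ring]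
    linear_combination eulerCoeffInt q (n + 1 + m) * this
  rw [e1, e2]; ring

lemma thetaCoeff_tendsto {q : ℂ} (hq : ‖q‖ < 1) (n : ℤ) :
    Filter.Tendsto (fun k : ℕ => thetaCoeff q (n + k)) Filter.atTop (nhds 0) := by
  have h := (hasSum_thetaCoeff hq one_ne_zero).summable
  simp only [one_zpow, mul_one] at h
  have := (h.comp_injective (i := fun k : ℕ => n + (k : ℤ))
    (fun a b h => by simpa using h)).tendsto_atTop_zero
  exact this

lemma thetaCoeff_succ {q : ℂ} (hq0 : q ≠ 0) (hq : ‖q‖ < 1) (n : ℤ) :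
    thetaCoeff q (n + 1) = -q ^ n * thetaCoeff q n := by
  have h1 : ∀ k : ℕ, thetaCoeff q (n + 1) + q ^ n * thetaCoeff q n =
      thetaCoeff q (n + 1 + k) + q ^ n * q ^ k * thetaCoeff q (n + k) := by
    intro k
    induction k with
    | zero => simp
    | succ k ih =>
      rw [ih]
      have := thetaCoeff_rec hq0 hq (n + k)
      rw [zpow_add₀ hq0, zpow_natCast, show n + (k : ℤ) + 2 = n + 1 + (k + 1 : ℕ) by push_cast; ring,
        show n + (k : ℤ) + 1 = n + (k + 1 : ℕ) by push_cast; ring,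
        show n + (k + 1 : ℕ) = n + 1 + (k : ℤ) by push_cast; ring] at this
      rw [this, show n + (k + 1 : ℕ) = n + 1 + (k : ℤ) by push_cast; ring,
        show q ^ n * q ^ (k + 1) = q ^ (n + 1 + (k : ℤ)) by
          rw [zpow_add₀ hq0, zpow_add₀ hq0, zpow_natCast, zpow_one]; ring]
  have h2 := (thetaCoeff_tendsto hq (n + 1)).add
    (((tendsto_pow_atTop_nhds_zero_of_norm_lt_one hq).const_mul (q ^ n)).mul
      (thetaCoeff_tendsto hq n))
  simp only [mul_zero, add_zero] at h2
  have h3 := tendsto_nhds_unique (tendsto_const_nhds.congr h1) h2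
  linear_combination h3

lemma thetaCoeff_eq {p : ℂ} (hp0 : p ≠ 0) (hp : ‖p‖ < 1) (n : ℤ) :
    thetaCoeff (p ^ 2) n = thetaCoeff (p ^ 2) 0 * ((-1) ^ n * p ^ (n * (n - 1))) := by
  have hq0 : p ^ 2 ≠ 0 := pow_ne_zero _ hp0
  have hq : ‖p ^ 2‖ < 1 := by rw [norm_pow]; exact pow_lt_one₀ (norm_nonneg _) hp two_ne_zero
  have hz (n : ℤ) : (p ^ 2) ^ n = p ^ (2 * n) := by rw [zpow_mul]; norm_cast
  induction n using Int.induction_on with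
  | zero => simp
  | succ k ih =>
    rw [thetaCoeff_succ hq0 hq, ih, hz, zpow_add₀ (by norm_num),
      show ((k : ℤ) + 1) * (k + 1 - 1) = 2 * k + k * (k - 1) by ring, zpow_add₀ hp0]
    simp; ring
  | pred k ih =>
    have h := thetaCoeff_succ hq0 hq (-(k : ℤ) - 1)
    rw [show -(k : ℤ) - 1 + 1 = -k by ring, ih, hz,
      show -(k : ℤ) * (-k - 1) = 2 * (-k - 1) + (-k - 1) * (-k - 1 - 1) by ring,
      zpow_add₀ hp0 ] at h
    have h0 := zpow_ne_zero (2 * (-(k : ℤ) - 1)) hp0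
    refine mul_left_cancel₀ h0 ?_
    rw [zpow_sub_one₀ (by norm_num)]
    simp only [inv_neg, inv_one]
    linear_combination h

/-- Jacobi's triple product, up to the normalising constant. -/
lemma hasSum_theta {p : ℂ} (hp0 : p ≠ 0) (hp : ‖p‖ < 1) {y : ℂ} (hy : y ≠ 0) :
    HasSum (fun n : ℤ => thetaCoeff (p ^ 2) 0 * ((-1) ^ n * p ^ (n * (n - 1))) * y ^ n)
      (theta y (p ^ 2)) := by
  have hq : ‖p ^ 2‖ < 1 := by rw [norm_pow]; exact pow_lt_one₀ (norm_nonneg _) hp two_ne_zero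
  exact (hasSum_thetaCoeff hq hy).congr_fun fun n => by rw [thetaCoeff_eq hp0 hp n]

/-! ### The Fourier expansion of the kernel -/

lemma leg_add_three (k : ℤ) : leg (k + 3) = leg k := by
  simp [leg]

lemma leg_neg (k : ℤ) : leg (-k) = -leg k := by
  unfold leg
  split_ifs <;> first | rfl | omega

lemma abs_leg_le (k : ℤ) : ‖(leg k : ℂ)‖ ≤ 1 := by
  unfold leg
  split_ifs <;> simp

lemma one_add_zpow_ne_zero {p : ℂ} (hp : ‖p‖ < 1) (k : ℤ) :
    1 + p ^ (2 * k + 1) ≠ 0 := by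
  intro h
  have h1 : ‖p‖ ^ (2 * k + 1) = 1 := by
    rw [← norm_zpow, show p ^ (2 * k + 1) = -1 by linear_combination h]; simp
  rw [zpow_eq_one_iff_right₀ (norm_nonneg _) hp.ne] at h1
  omega

/-- The Fourier coefficients of the kernel of the pfaffian. -/
def kerCoeff (p : ℂ) (k : ℤ) : ℂ := (leg (k + 2) : ℂ) * (p ^ k / (1 + p ^ (2 * k + 1)))

lemma kerCoeff_reflect {p : ℂ} (hp0 : p ≠ 0) (hp : ‖p‖ < 1) (k : ℤ) :
    kerCoeff p (-1 - k) = -kerCoeff p k := by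
  have h1 : leg (-1 - k + 2) = -leg (k + 2) := by
    rw [show -1 - k + 2 = -(k - 1) by ring, leg_neg, ← leg_add_three (k - 1)]
    congr 2; ring
  have h2 := one_add_zpow_ne_zero hp k
  have h3 := one_add_zpow_ne_zero hp (-1 - k)
  have h4 : p ^ (-1 - k) * (1 + p ^ (2 * k + 1)) = p ^ k * (1 + p ^ (2 * (-1 - k) + 1)) := by
    rw [mul_add, mul_add, ← zpow_add₀ hp0, ← zpow_add₀ hp0, add_comm]
    ring_nf
  rw [kerCoeff, kerCoeff, h1]
  push_cast
  rw [neg_mul, (div_eq_div_iff h3 h2).2 h4]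

lemma norm_kerCoeff_le {p : ℂ} (hp : ‖p‖ < 1) (k : ℕ) :
    ‖kerCoeff p k‖ ≤ (1 - ‖p‖)⁻¹ * ‖p‖ ^ k := by
  have h1 : 1 - ‖p‖ ≤ ‖1 + p ^ (2 * k + 1)‖ := by
    have h2 : ‖p ^ (2 * k + 1)‖ ≤ ‖p‖ := by
      rw [norm_pow]; exact pow_le_of_le_one (norm_nonneg _) hp.le (by omega)
    have h3 := norm_sub_norm_le (1 : ℂ) (-p ^ (2 * k + 1))
    rw [norm_neg, norm_one, sub_neg_eq_add] at h3
    linarith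
  have h0 : 0 < 1 - ‖p‖ := by linarith
  rw [kerCoeff, norm_mul, norm_div, show (2 * (k : ℤ) + 1) = ((2 * k + 1 : ℕ) : ℤ) by push_cast; ring,
    zpow_natCast, zpow_natCast, norm_pow, div_eq_inv_mul]
  calc _ ≤ 1 * ((1 - ‖p‖)⁻¹ * ‖p‖ ^ k) := by gcongr; exact abs_leg_le _
    _ = _ := one_mul _

lemma summable_kerCoeff {p : ℂ} (hp0 : p ≠ 0) (hp : ‖p‖ < 1) {y : ℂ} (h1 : ‖p‖ < ‖y‖)
    (h2 : ‖p‖ * ‖y‖ < 1) : Summable fun k : ℤ => ‖kerCoeff p k * y ^ k‖ := by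
  have hy : 0 < ‖y‖ := (norm_nonneg _).trans_lt h1
  refine Summable.of_nat_of_neg_add_one ?_ ?_
  · refine Summable.of_nonneg_of_le (fun _ => norm_nonneg _) (fun k => ?_)
      ((summable_geometric_of_lt_one (by positivity) h2).mul_left ((1 - ‖p‖)⁻¹))
    rw [norm_mul, zpow_natCast, norm_pow, mul_pow, ← mul_assoc]
    gcongr
    exact norm_kerCoeff_le hp k
  · refine Summable.of_nonneg_of_le (fun _ => norm_nonneg _) (fun k => ?_)
      ((summable_geometric_of_lt_one (r := ‖p‖ / ‖y‖) (by positivity)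
        ((div_lt_one hy).2 h1)).mul_left ((1 - ‖p‖)⁻¹ * ‖y‖⁻¹))
    rw [show (-((k : ℤ) + 1)) = -1 - k by ring, kerCoeff_reflect hp0 hp, norm_mul, norm_neg,
      norm_zpow, zpow_sub₀ hy.ne', zpow_neg_one, zpow_natCast, div_pow]
    have := norm_kerCoeff_le hp k
    calc _ ≤ ((1 - ‖p‖)⁻¹ * ‖p‖ ^ k) * (‖y‖⁻¹ / ‖y‖ ^ k) := by gcongr
      _ = _ := by ring

lemma eq_zero_of_recurrence {p : ℂ} (hp0 : p ≠ 0) {d : ℤ → ℂ}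
    (h3 : ∀ j, d (j + 3) = p ^ (2 * j + 4) * d j) (hs : ∀ j, d (-1 - j) = -d j) (d0 : d 0 = 0)
    (j : ℤ) : d j = 0 := by
  have dm1 : d (-1) = 0 := by simpa [d0] using hs 0
  have d1 : d 1 = 0 := by
    have e1 := hs 1
    have e2 := h3 (-2)
    norm_num at e1 e2
    rw [e1] at e2
    linear_combination e2 / 2
  have key : ∀ j, d (j - 1) = 0 ∧ d j = 0 ∧ d (j + 1) = 0 := by
    intro j
    induction j using Int.induction_on with
    | zero => exact ⟨by simpa using dm1, d0, by simpa using d1⟩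
    | succ k ih =>
      refine ⟨by simpa using ih.2.1, ih.2.2, ?_⟩
      rw [show (k : ℤ) + 1 + 1 = k - 1 + 3 by ring, h3, ih.1, mul_zero]
    | pred k ih =>
      refine ⟨?_, ih.1, by simpa using ih.2.1⟩
      have := h3 (-(k : ℤ) - 1 - 1)
      rw [show -(k : ℤ) - 1 - 1 + 3 = -k + 1 by ring, ih.2.2, zero_eq_mul] at this
      exact this.resolve_left (zpow_ne_zero _ hp0)
  exact (key j).2.1

lemma eq_mul_of_recurrence {p : ℂ} (hp0 : p ≠ 0) {b r : ℤ → ℂ}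
    (hb : ∀ j, b (j + 3) = p ^ (2 * j + 4) * b j) (hb' : ∀ j, b (-1 - j) = -b j)
    (hr : ∀ j, r (j + 3) = p ^ (2 * j + 4) * r j) (hr' : ∀ j, r (-1 - j) = -r j) (j : ℤ) :
    b j * r 0 = r j * b 0 :=
  sub_eq_zero.1 <| eq_zero_of_recurrence hp0 (d := fun j => b j * r 0 - r j * b 0)
    (fun j => by simp only [hb, hr]; ring) (fun j => by simp only [hb', hr']; ring) (by ring) j

lemma qpoch_mul_neg {q : ℂ} (hq : ‖q‖ < 1) (a : ℂ) :
    qpoch a q * qpoch (-a) q = qpoch (a ^ 2) (q ^ 2) := by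
  rw [qpoch, qpoch, ← (multipliable_qpoch hq a).tprod_mul (multipliable_qpoch hq (-a)), qpoch]
  exact tprod_congr fun j => by ring

lemma theta_mul_neg {q : ℂ} (hq : ‖q‖ < 1) (y : ℂ) :
    theta y q * theta (-y) q = theta (y ^ 2) (q ^ 2) := by
  rw [theta, theta, theta, ← qpoch_mul_neg hq, ← div_pow, ← qpoch_mul_neg hq, div_neg]
  ring

/-- The Laurent coefficients of `θ(y; p²) θ(p²y²; p⁴) / y`. -/
def numCoeff (p : ℂ) (j : ℤ) : ℂ :=
  ∑' n : ℤ, (-1) ^ (j + 1 - 2 * n) * p ^ ((j + 1 - 2 * n) * (j - 2 * n)) * ((-1) ^ n * p ^ (2 * n ^ 2))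

lemma neg_one_zpow_eq_of_even {a b : ℤ} (h : Even (a - b)) : (-1 : ℂ) ^ a = (-1) ^ b := by
  rw [← sub_add_cancel a b, zpow_add₀ (by norm_num), h.neg_one_zpow, one_mul]

lemma neg_one_zpow_eq_of_odd {a b : ℤ} (h : Odd (a - b)) : (-1 : ℂ) ^ a = -(-1) ^ b := by
  rw [← sub_add_cancel a b, zpow_add₀ (by norm_num), h.neg_one_zpow, neg_one_mul]

lemma numCoeff_rec {p : ℂ} (hp0 : p ≠ 0) (j : ℤ) :
    numCoeff p (j + 3) = p ^ (2 * j + 4) * numCoeff p j := by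
  rw [numCoeff, numCoeff, ← (Equiv.addRight (1 : ℤ)).tsum_eq, ← tsum_mul_left]
  refine tsum_congr fun n => ?_
  simp only [Equiv.coe_addRight]
  have e1 : p ^ ((j + 3 + 1 - 2 * (n + 1)) * (j + 3 - 2 * (n + 1))) * p ^ (2 * (n + 1) ^ 2) =
      p ^ (2 * j + 4) * (p ^ ((j + 1 - 2 * n) * (j - 2 * n)) * p ^ (2 * n ^ 2)) := by
    rw [← zpow_add₀ hp0, ← zpow_add₀ hp0, ← zpow_add₀ hp0]; congr 1; ring
  have e2 : (-1 : ℂ) ^ (j + 3 + 1 - 2 * (n + 1)) * (-1) ^ (n + 1) =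
      (-1) ^ (j + 1 - 2 * n) * (-1) ^ n := by
    rw [← zpow_add₀ (by norm_num), ← zpow_add₀ (by norm_num)]
    exact neg_one_zpow_eq_of_even ⟨1, by ring⟩
  linear_combination p ^ ((j + 3 + 1 - 2 * (n + 1)) * (j + 3 - 2 * (n + 1))) * p ^ (2 * (n + 1) ^ 2) * e2 +
    (-1 : ℂ) ^ (j + 1 - 2 * n) * (-1) ^ n * e1

lemma numCoeff_reflect (p : ℂ) (j : ℤ) : numCoeff p (-1 - j) = -numCoeff p j := by
  rw [numCoeff, numCoeff, ← (Equiv.neg ℤ).tsum_eq, ← tsum_neg]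
  refine tsum_congr fun n => ?_
  simp only [Equiv.neg_apply]
  have e1 : (-1 : ℂ) ^ (-1 - j + 1 - 2 * -n) * (-1) ^ (-n) = -((-1) ^ (j + 1 - 2 * n) * (-1) ^ n) := by
    rw [← zpow_add₀ (by norm_num), ← zpow_add₀ (by norm_num)]
    exact neg_one_zpow_eq_of_odd ⟨n - j - 1, by ring⟩
  rw [show (-1 - j + 1 - 2 * -n) * (-1 - j - 2 * -n) = (j + 1 - 2 * n) * (j - 2 * n) by ring, neg_sq]
  linear_combination p ^ ((j + 1 - 2 * n) * (j - 2 * n)) * p ^ (2 * n ^ 2) * e1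

lemma hasSum_numCoeff {p : ℂ} (hp0 : p ≠ 0) (hp : ‖p‖ < 1) {y : ℂ} (hy : y ≠ 0) :
    HasSum (fun j : ℤ => thetaCoeff (p ^ 2) 0 * thetaCoeff (p ^ 4) 0 * numCoeff p j * (y * y ^ j))
      (theta y (p ^ 2) * (theta (p * y) (p ^ 2) * theta (-(p * y)) (p ^ 2))) := by
  have hq : ‖p ^ 2‖ < 1 := by rw [norm_pow]; exact pow_lt_one₀ (norm_nonneg _) hp two_ne_zero
  have h1 := hasSum_theta hp0 hp hy
  have h2 := hasSum_theta (p := p ^ 2) (pow_ne_zero _ hp0) hq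
    (y := (p * y) ^ 2) (pow_ne_zero _ (mul_ne_zero hp0 hy))
  rw [← theta_mul_neg hq, ← pow_mul] at h2
  have h3 : HasSum (fun n : ℤ => thetaCoeff (p ^ 4) 0 * ((-1) ^ n * p ^ (2 * n ^ 2)) * y ^ (2 * n))
      (theta (p * y) (p ^ 2) * theta (-(p * y)) (p ^ 2)) := by
    refine h2.congr_fun fun n => ?_
    have e (x : ℂ) (m : ℤ) : (x ^ 2) ^ m = x ^ (2 * m) := by rw [zpow_mul]; norm_cast
    rw [e, e, mul_zpow, show 2 * n ^ 2 = 2 * (n * (n - 1)) + 2 * n by ring, zpow_add₀ hp0]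
    ring
  have h4 := laurent_conv 2 hy h1.summable.norm h3.summable.norm
  rw [h1.tsum_eq, h3.tsum_eq, ← (Equiv.addRight (1 : ℤ)).hasSum_iff] at h4
  refine h4.congr_fun fun j => ?_
  simp only [Function.comp, Equiv.coe_addRight, numCoeff, ← tsum_mul_left]
  rw [← zpow_one_add₀ hy, add_comm 1 j]
  congr 1
  refine tsum_congr fun n => ?_
  rw [show j + 1 - 2 * n - 1 = j - 2 * n by ring]
  ring

/-- The Laurent coefficients of the kernel times its denominator. -/
def prodCoeff (p : ℂ) (j : ℤ) : ℂ :=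
  ∑' n : ℤ, kerCoeff p (j - 3 * n) * ((-1) ^ n * p ^ (3 * n ^ 2))

lemma hasSum_theta_cube {p : ℂ} (hp0 : p ≠ 0) (hp : ‖p‖ < 1) {y : ℂ} (hy : y ≠ 0) :
    HasSum (fun n : ℤ => thetaCoeff (p ^ 6) 0 * ((-1) ^ n * p ^ (3 * n ^ 2)) * y ^ (3 * n))
      (theta (p ^ 3 * y ^ 3) (p ^ 6)) := by
  have hq : ‖p ^ 3‖ < 1 := by rw [norm_pow]; exact pow_lt_one₀ (norm_nonneg _) hp three_ne_zero
  have h2 := hasSum_theta (p := p ^ 3) (pow_ne_zero _ hp0) hq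
    (y := p ^ 3 * y ^ 3) (mul_ne_zero (pow_ne_zero _ hp0) (pow_ne_zero _ hy))
  rw [← pow_mul] at h2
  refine h2.congr_fun fun n => ?_
  have e (x : ℂ) (m : ℤ) : (x ^ 3) ^ m = x ^ (3 * m) := by rw [zpow_mul]; norm_cast
  rw [mul_zpow, e, e, e, show 3 * n ^ 2 = 3 * (n * (n - 1)) + 3 * n by ring, zpow_add₀ hp0]
  ring

lemma thetaCoeff_zero_ne_zero {p : ℂ} (hp0 : p ≠ 0) (hp : ‖p‖ < 1) : thetaCoeff (p ^ 2) 0 ≠ 0 := by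
  have hq : ‖p ^ 2‖ < 1 := by rw [norm_pow]; exact pow_lt_one₀ (norm_nonneg _) hp two_ne_zero
  intro h
  have h1 := (hasSum_theta hp0 hp hp0).tsum_eq
  have h2 := qpoch_ne_zero hq hp
  rw [theta, show p ^ 2 / p = p by field_simp] at h1
  simp only [h, zero_mul, tsum_zero] at h1
  exact mul_ne_zero h2 h2 h1.symm

lemma summable_theta_cube {p : ℂ} (hp0 : p ≠ 0) (hp : ‖p‖ < 1) {y : ℂ} (hy : y ≠ 0) :
    Summable fun n : ℤ => (-1) ^ n * p ^ (3 * n ^ 2) * y ^ (3 * n) := by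
  have hq : ‖p ^ 3‖ < 1 := by rw [norm_pow]; exact pow_lt_one₀ (norm_nonneg _) hp three_ne_zero
  have h0 := thetaCoeff_zero_ne_zero (pow_ne_zero 3 hp0) hq
  rw [← pow_mul] at h0
  have := (hasSum_theta_cube hp0 hp hy).summable
  simp only [mul_assoc] at this ⊢
  exact (summable_mul_left_iff h0).1 this

lemma prodCoeff_reflect {p : ℂ} (hp0 : p ≠ 0) (hp : ‖p‖ < 1) (j : ℤ) :
    prodCoeff p (-1 - j) = -prodCoeff p j := by
  rw [prodCoeff, prodCoeff, ← (Equiv.neg ℤ).tsum_eq, ← tsum_neg]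
  refine tsum_congr fun n => ?_
  simp only [Equiv.neg_apply]
  rw [show -1 - j - 3 * -n = -1 - (j - 3 * n) by ring, kerCoeff_reflect hp0 hp, neg_sq,
    neg_one_zpow_eq_of_even (a := -n) (b := n) ⟨-n, by ring⟩, neg_mul]

lemma prodCoeff_rec {p : ℂ} (hp0 : p ≠ 0) (hp : ‖p‖ < 1) (j : ℤ) :
    prodCoeff p (j + 3) = p ^ (2 * j + 4) * prodCoeff p j := by
  have hs1 : Summable fun n : ℤ => kerCoeff p (j - 3 * n) * ((-1) ^ n * p ^ (3 * n ^ 2)) :=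
    laurent_conv_summable 3 one_ne_zero
      (summable_kerCoeff hp0 hp (by simpa using hp) (by simpa using hp))
      (summable_theta_cube hp0 hp one_ne_zero).norm j
  have hs2 := summable_theta_cube hp0 hp hp0
  have h0 : ∑' n : ℤ, (-1) ^ n * p ^ (3 * n ^ 2) * p ^ (3 * n) = 0 := by
    have e : ∑' n : ℤ, (-1) ^ n * p ^ (3 * n ^ 2) * p ^ (3 * n) =
        -∑' n : ℤ, (-1) ^ n * p ^ (3 * n ^ 2) * p ^ (3 * n) := by
      conv_lhs => rw [← (Equiv.subLeft (-1 : ℤ)).tsum_eq]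
      rw [← tsum_neg]
      refine tsum_congr fun n => ?_
      simp only [Equiv.subLeft_apply]
      rw [neg_one_zpow_eq_of_odd (a := -1 - n) (b := n) ⟨-n - 1, by ring⟩, mul_assoc, mul_assoc,
        ← zpow_add₀ hp0, ← zpow_add₀ hp0]
      rw [neg_mul]; congr 3; ring
    linear_combination e / 2
  have key : ∀ n : ℤ, kerCoeff p (j + 3 - 3 * (n + 1)) * ((-1) ^ (n + 1) * p ^ (3 * (n + 1) ^ 2)) =
      p ^ (2 * j + 4) * (kerCoeff p (j - 3 * n) * ((-1) ^ n * p ^ (3 * n ^ 2))) -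
        (leg (j + 2) * p ^ (j + 3)) * ((-1) ^ n * p ^ (3 * n ^ 2) * p ^ (3 * n)) := by
    intro n
    have hl : leg (j - 3 * n + 2) = leg (j + 2) := by
      unfold leg
      rw [show (j - 3 * n + 2) % 3 = (j + 2) % 3 by omega]
    have hne := one_add_zpow_ne_zero hp (j - 3 * n)
    rw [show j + 3 - 3 * (n + 1) = j - 3 * n by ring,
      neg_one_zpow_eq_of_odd (a := n + 1) (b := n) ⟨0, by ring⟩, kerCoeff, hl]
    have e1 : p ^ (j - 3 * n) * p ^ (3 * (n + 1) ^ 2) = p ^ (j + 3) * p ^ (3 * n ^ 2) * p ^ (3 * n) := by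
      rw [← zpow_add₀ hp0, ← zpow_add₀ hp0, ← zpow_add₀ hp0]; congr 1; ring
    have e2 : p ^ (2 * j + 4) * p ^ (j - 3 * n) =
        p ^ (j + 3) * p ^ (3 * n) * p ^ (2 * (j - 3 * n) + 1) := by
      rw [← zpow_add₀ hp0, ← zpow_add₀ hp0, ← zpow_add₀ hp0]; congr 1; ring
    field_simp
    linear_combination (-(leg (j + 2) : ℂ)) * e1 - ((leg (j + 2) : ℂ) * p ^ (3 * n ^ 2)) * e2
  rw [prodCoeff, prodCoeff, ← (Equiv.addRight (1 : ℤ)).tsum_eq]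
  simp only [Equiv.coe_addRight]
  simp only [key]
  rw [(hs1.mul_left _).tsum_sub (hs2.mul_left _), tsum_mul_left, tsum_mul_left, h0, mul_zero, sub_zero]

/-- The Laurent series of the kernel, divided by `x` and in the variable `y = x²`. -/
def kerSeries (p y : ℂ) : ℂ := ∑' k : ℤ, kerCoeff p k * y ^ k

lemma numCoeff_zero_ne_zero {p : ℂ} (hp0 : p ≠ 0) (hp : ‖p‖ < 1) {y : ℂ} (hy : y ≠ 0)
    (h : theta y (p ^ 2) * (theta (p * y) (p ^ 2) * theta (-(p * y)) (p ^ 2)) ≠ 0) :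
    numCoeff p 0 ≠ 0 := by
  intro h0
  refine h ((hasSum_numCoeff hp0 hp hy).unique ?_)
  simp only [eq_zero_of_recurrence hp0 (numCoeff_rec hp0) (numCoeff_reflect p) h0, mul_zero,
    zero_mul]
  exact hasSum_zero

lemma exists_kerSeries_mul_theta {p : ℂ} (hp0 : p ≠ 0) (hp : ‖p‖ < 1) :
    ∃ α β : ℂ, (numCoeff p 0 ≠ 0 → α ≠ 0) ∧ ∀ y : ℂ, ‖p‖ < ‖y‖ → ‖p‖ * ‖y‖ < 1 →
      α * (y * kerSeries p y * theta (p ^ 3 * y ^ 3) (p ^ 6)) =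
        β * (theta y (p ^ 2) * (theta (p * y) (p ^ 2) * theta (-(p * y)) (p ^ 2))) := by
  refine ⟨thetaCoeff (p ^ 2) 0 * thetaCoeff (p ^ 4) 0 * numCoeff p 0,
    thetaCoeff (p ^ 6) 0 * prodCoeff p 0, fun h => ?_, fun y h1 h2 => ?_⟩
  · have hq : ‖p ^ 2‖ < 1 := by rw [norm_pow]; exact pow_lt_one₀ (norm_nonneg _) hp two_ne_zero
    have h4 := thetaCoeff_zero_ne_zero (pow_ne_zero 2 hp0) hq
    rw [← pow_mul] at h4
    exact mul_ne_zero (mul_ne_zero (thetaCoeff_zero_ne_zero hp0 hp) h4) h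
  have hy : y ≠ 0 := norm_pos_iff.1 ((norm_nonneg _).trans_lt h1)
  have h3 := hasSum_theta_cube hp0 hp hy
  have h4 := laurent_conv 3 hy (summable_kerCoeff hp0 hp h1 h2) h3.summable.norm
  rw [h3.tsum_eq] at h4
  have h5 := (h4.mul_left y).mul_left
    (thetaCoeff (p ^ 2) 0 * thetaCoeff (p ^ 4) 0 * numCoeff p 0)
  have h6 := (hasSum_numCoeff hp0 hp hy).mul_left (thetaCoeff (p ^ 6) 0 * prodCoeff p 0)
  rw [← mul_assoc y] at h5
  refine h5.unique (h6.congr_fun fun j => ?_)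
  have e := eq_mul_of_recurrence hp0 (prodCoeff_rec hp0 hp) (prodCoeff_reflect hp0 hp)
    (numCoeff_rec hp0) (numCoeff_reflect p) j
  have e2 : ∑' n : ℤ, kerCoeff p (j - 3 * n) * (thetaCoeff (p ^ 6) 0 * ((-1) ^ n * p ^ (3 * n ^ 2))) =
      thetaCoeff (p ^ 6) 0 * prodCoeff p j := by
    rw [prodCoeff, ← tsum_mul_left]; exact tsum_congr fun n => by ring
  rw [e2]
  linear_combination (thetaCoeff (p ^ 2) 0 * thetaCoeff (p ^ 4) 0 * thetaCoeff (p ^ 6) 0 * y * y ^ j) * e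

/-! ### The constant `C₂` -/

lemma qpoch_even_odd {q : ℂ} (hq : ‖q‖ < 1) (a : ℂ) :
    qpoch a q = qpoch a (q ^ 2) * qpoch (a * q) (q ^ 2) := by
  have hq2 : ‖q ^ 2‖ < 1 := by rw [norm_pow]; exact pow_lt_one₀ (norm_nonneg _) hq two_ne_zero
  have e1 : ∀ k : ℕ, 1 - a * q ^ (2 * k) = 1 - a * (q ^ 2) ^ k := fun k => by rw [pow_mul]
  have e2 : ∀ k : ℕ, 1 - a * q ^ (2 * k + 1) = 1 - a * q * (q ^ 2) ^ k := fun k => by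
    rw [pow_succ, pow_mul]; ring
  have := tprod_even_mul_odd (f := fun j : ℕ => 1 - a * q ^ j)
    (by simpa only [e1] using multipliable_qpoch hq2 a)
    (by simpa only [e2] using multipliable_qpoch hq2 (a * q))
  rw [qpoch, ← this, qpoch, qpoch]
  simp only [e1, e2]

lemma qpoch_cube {q w : ℂ} (hq : ‖q‖ < 1) (hw : 1 + w + w ^ 2 = 0) (a : ℂ) :
    qpoch a q * qpoch (w * a) q * qpoch (w ^ 2 * a) q = qpoch (a ^ 3) (q ^ 3) := by
  have h1 := multipliable_qpoch hq a
  have h2 := multipliable_qpoch hq (w * a)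
  have h3 := multipliable_qpoch hq (w ^ 2 * a)
  rw [qpoch, qpoch, qpoch, ← h1.tprod_mul h2, ← (h1.mul h2).tprod_mul h3, qpoch]
  refine tprod_congr fun j => ?_
  rw [show (q ^ 3) ^ j = (q ^ j) ^ 3 by ring]
  generalize q ^ j = t
  have h3 : w ^ 3 = 1 := by linear_combination (w - 1) * hw
  linear_combination (-(a * t) + (a * t) ^ 2 * w) * hw - (a * t) ^ 3 * h3

lemma qpoch_identity {p : ℂ} (hp : ‖p‖ < 1) :
    qpoch (-p) (-p) * (qpoch p (p ^ 2) * qpoch (p ^ 4) (p ^ 4)) = qpoch (p ^ 2) (p ^ 2) ^ 2 := by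
  have hq : ‖p ^ 2‖ < 1 := by rw [norm_pow]; exact pow_lt_one₀ (norm_nonneg _) hp two_ne_zero
  have h1 := qpoch_even_odd (q := -p) (by simpa using hp) (-p)
  have h2 := qpoch_even_odd hq (p ^ 2)
  have h3 := qpoch_mul_neg hq p
  rw [show (-p) ^ 2 = p ^ 2 by ring, show -p * -p = p ^ 2 by ring] at h1
  rw [show (p ^ 2) ^ 2 = p ^ 4 by ring, show p ^ 2 * p ^ 2 = p ^ 4 by ring] at h2
  rw [show (p ^ 2) ^ 2 = p ^ 4 by ring] at h3
  rw [h1]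
  calc _ = qpoch (p ^ 2) (p ^ 2) * ((qpoch p (p ^ 2) * qpoch (-p) (p ^ 2)) * qpoch (p ^ 4) (p ^ 4)) := by
        ring
    _ = _ := by rw [h3, ← h2]; ring

lemma C2_identity {p : ℂ} (hp : ‖p‖ < 1) :
    C2 p * qpoch (p ^ 6) (p ^ 6) ^ 2 * (qpoch p (p ^ 2) * qpoch (p ^ 4) (p ^ 4)) =
      qpoch (p ^ 3) (p ^ 6) * qpoch (p ^ 12) (p ^ 12) := by
  have hn (k : ℕ) (hk : k ≠ 0) : ‖p ^ k‖ < 1 := by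
    rw [norm_pow]; exact pow_lt_one₀ (norm_nonneg _) hp hk
  have h1 := qpoch_identity hp
  have h2 := qpoch_identity (hn 3 (by norm_num))
  simp only [← pow_mul] at h2
  norm_num at h2
  have n1 := qpoch_ne_zero (hn 2 (by norm_num)) (hn 2 (by norm_num))
  have n2 : qpoch (-p ^ 3) (-p ^ 3) ≠ 0 :=
    qpoch_ne_zero (by simpa using hn 3 (by norm_num)) (by simpa using hn 3 (by norm_num))
  rw [C2]
  field_simp
  linear_combination qpoch (p ^ 6) (p ^ 6) ^ 2 * h1 - qpoch (p ^ 2) (p ^ 2) ^ 2 * h2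

lemma theta_identity {p w : ℂ} (hp0 : p ≠ 0) (hp : ‖p‖ < 1) (hw : 1 + w + w ^ 2 = 0) :
    theta (w / p) (p ^ 2) * (theta (p * (w / p)) (p ^ 2) * theta (-(p * (w / p))) (p ^ 2)) =
      C2 p * (-(w / p) * (1 - w ^ 2) * qpoch (p ^ 6) (p ^ 6) ^ 2) := by
  have hn (k : ℕ) (hk : k ≠ 0) : ‖p ^ k‖ < 1 := by
    rw [norm_pow]; exact pow_lt_one₀ (norm_nonneg _) hp hk
  have hw3 : w ^ 3 = 1 := by linear_combination (w - 1) * hw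
  have hw0 : w ≠ 0 := by rintro rfl; norm_num at hw
  have hw' : ‖w‖ = 1 := norm_eq_one_of_pow_eq_one hw3 (by norm_num)
  have h2 := hn 2 (by norm_num)
  have h4 := hn 4 (by norm_num)
  rw [theta_mul_neg h2, mul_div_cancel₀ _ hp0, ← pow_mul]
  norm_num
  have t1 : qpoch p (p ^ 2) * theta (w / p) (p ^ 2) = -(w / p) * qpoch (p ^ 3) (p ^ 6) := by
    have e1 := qpoch_succ h2 (w / p)
    have e2 := qpoch_succ h2 (w ^ 2 * p)
    have e3 := qpoch_cube h2 hw p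
    rw [← pow_mul] at e3
    norm_num at e3
    rw [show w / p * p ^ 2 = w * p by field_simp] at e1
    have e4 : 1 - w / p = -(w / p) * (1 - w ^ 2 * p) := by
      field_simp; linear_combination -p * hw3
    rw [theta, show p ^ 2 / (w / p) = w ^ 2 * p * p ^ 2 by
      field_simp; linear_combination -hw3, e1, e4, ← e3]
    rw [e2]; ring
  have t2 : qpoch (p ^ 4) (p ^ 4) * theta (w ^ 2) (p ^ 4) = (1 - w ^ 2) * qpoch (p ^ 12) (p ^ 12) := by
    have e1 := qpoch_succ h4 (w ^ 2)
    have e3 := qpoch_cube h4 hw (p ^ 4)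
    rw [← pow_mul] at e3
    norm_num at e3
    rw [theta, show p ^ 4 / w ^ 2 = w * p ^ 4 by field_simp; linear_combination -hw3, e1, ← e3]
    ring
  have n1 := qpoch_ne_zero h2 hp
  have n2 := qpoch_ne_zero h4 h4
  refine mul_left_cancel₀ (mul_ne_zero n1 n2) ?_
  have := C2_identity hp
  linear_combination theta (w ^ 2) (p ^ 4) * qpoch (p ^ 4) (p ^ 4) * t1 -
    (w / p) * qpoch (p ^ 3) (p ^ 6) * t2 + (w / p) * (1 - w ^ 2) * this

lemma C2_ne_zero {p : ℂ} (hp : ‖p‖ < 1) : C2 p ≠ 0 := by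
  have hn (k : ℕ) (hk : k ≠ 0) : ‖p ^ k‖ < 1 := by
    rw [norm_pow]; exact pow_lt_one₀ (norm_nonneg _) hp hk
  have h3 := hn 3 (by norm_num)
  have h2 := hn 2 (by norm_num)
  refine div_ne_zero (qpoch_ne_zero (by simpa using hp) (by simpa using hp)) (mul_ne_zero
    (pow_ne_zero _ (qpoch_ne_zero h2 h2)) (qpoch_ne_zero (by simpa using h3) (by simpa using h3)))

lemma tsum_leg_mul_pow {t : ℂ} (ht : ‖t‖ < 1) :
    (1 + t + t ^ 2) * ∑' k : ℕ, (leg (k + 2) : ℂ) * t ^ k = -(1 + t) := by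
  have hs : Summable fun k : ℕ => (leg (k + 2) : ℂ) * t ^ k := by
    refine Summable.of_norm_bounded (summable_geometric_of_lt_one (norm_nonneg _) ht) fun k => ?_
    rw [norm_mul, norm_pow]
    exact mul_le_of_le_one_left (by positivity) (abs_leg_le _)
  have h1 := hs.sum_add_tsum_nat_add 1
  have h2 := hs.sum_add_tsum_nat_add 2
  have s1 := ((summable_nat_add_iff 1).2 hs).mul_left t
  have s2 := (summable_nat_add_iff 2).2 hs
  have h3 : (∑' k : ℕ, (leg ((k + 2 : ℕ) + 2) : ℂ) * t ^ (k + 2)) +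
      t * (∑' k : ℕ, (leg ((k + 1 : ℕ) + 2) : ℂ) * t ^ (k + 1)) +
      t ^ 2 * ∑' k : ℕ, (leg (k + 2) : ℂ) * t ^ k = 0 := by
    rw [← tsum_mul_left, ← tsum_mul_left, ← s2.tsum_add s1, ← (s2.add s1).tsum_add (hs.mul_left _)]
    convert tsum_zero with k
    have : leg ((k + 2 : ℕ) + 2) + leg ((k + 1 : ℕ) + 2) + leg (k + 2) = 0 := by
      unfold leg; push_cast; split_ifs <;> omega
    have h' : (leg ((k + 2 : ℕ) + 2) : ℂ) + leg ((k + 1 : ℕ) + 2) + leg (k + 2) = 0 := by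
      exact_mod_cast this
    linear_combination t ^ (k + 2) * h'
  simp [Finset.sum_range_succ, leg] at h1 h2 h3 ⊢
  linear_combination h3 - h2 - t * h1

/-! ### Theta quotients as Laurent series -/

lemma kerSeries_near_pole {p : ℂ} (hp0 : p ≠ 0) (hp : ‖p‖ < 1) :
    ∃ M : ℝ, ∀ y : ℂ, 1 ≤ ‖y‖ → ‖p‖ * ‖y‖ < 1 →
      ‖(1 + p * y + (p * y) ^ 2) * kerSeries p y + (1 + p * y)‖ ≤
        M * ‖1 + p * y + (p * y) ^ 2‖ := by
  have hgeo := (summable_geometric_of_lt_one (norm_nonneg _) hp).mul_left ((1 - ‖p‖)⁻¹)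
  set G : ℝ := ∑' k : ℕ, (1 - ‖p‖)⁻¹ * ‖p‖ ^ k
  refine ⟨G + G, fun y h1 h2 => ?_⟩
  have hy : y ≠ 0 := by rintro rfl; norm_num at h1
  have ht : ‖p * y‖ < 1 := by rwa [norm_mul]
  have b1 : ∀ k : ℕ, ‖kerCoeff p k * y ^ k * p ^ (2 * k + 1)‖ ≤ (1 - ‖p‖)⁻¹ * ‖p‖ ^ k := by
    intro k
    have hinv : 0 ≤ (1 - ‖p‖)⁻¹ := inv_nonneg.2 (by linarith)
    rw [norm_mul, norm_mul, norm_pow, norm_pow]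
    calc ‖kerCoeff p k‖ * ‖y‖ ^ k * ‖p‖ ^ (2 * k + 1)
        ≤ (1 - ‖p‖)⁻¹ * ‖p‖ ^ k * ‖y‖ ^ k * ‖p‖ ^ (2 * k + 1) := by
          gcongr; exact norm_kerCoeff_le hp k
      _ = (1 - ‖p‖)⁻¹ * ((‖p‖ * ‖y‖) ^ k * ‖p‖ ^ (2 * k + 1)) := by ring
      _ ≤ (1 - ‖p‖)⁻¹ * (1 * ‖p‖ ^ k) := by
          refine mul_le_mul_of_nonneg_left (mul_le_mul ?_ ?_ (by positivity) zero_le_one) hinv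
          · exact pow_le_one₀ (by positivity) h2.le
          · exact pow_le_pow_of_le_one (norm_nonneg _) hp.le (by omega)
      _ = _ := by rw [one_mul]
  have b2 : ∀ k : ℕ, ‖kerCoeff p k * y⁻¹ ^ (k + 1)‖ ≤ (1 - ‖p‖)⁻¹ * ‖p‖ ^ k := by
    intro k
    rw [norm_mul, norm_pow, norm_inv]
    calc _ ≤ ‖kerCoeff p k‖ * 1 := by
          gcongr; exact pow_le_one₀ (by positivity) (inv_le_one_of_one_le₀ h1)
      _ ≤ _ := by rw [mul_one]; exact norm_kerCoeff_le hp k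
  have s1 := Summable.of_norm_bounded hgeo b1
  have s2 := Summable.of_norm_bounded hgeo b2
  have s0 : Summable fun k : ℕ => (leg (k + 2) : ℂ) * (p * y) ^ k := by
    refine Summable.of_norm_bounded (summable_geometric_of_lt_one (norm_nonneg _) ht) fun k => ?_
    rw [norm_mul, norm_pow]
    exact mul_le_of_le_one_left (by positivity) (abs_leg_le _)
  have e : kerSeries p y = (∑' k : ℕ, (leg (k + 2) : ℂ) * (p * y) ^ k) -
      (∑' k : ℕ, kerCoeff p k * y ^ k * p ^ (2 * k + 1)) -
      ∑' k : ℕ, kerCoeff p k * y⁻¹ ^ (k + 1) := by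
    refine HasSum.tsum_eq ?_
    rw [sub_eq_add_neg _ (∑' k : ℕ, kerCoeff p k * y⁻¹ ^ (k + 1))]
    refine HasSum.of_nat_of_neg_add_one ?_ ?_
    · refine (s0.hasSum.sub s1.hasSum).congr_fun fun k => ?_
      have hne := one_add_zpow_ne_zero hp k
      rw [show (2 * (k : ℤ) + 1) = ((2 * k + 1 : ℕ) : ℤ) by push_cast; ring, zpow_natCast] at hne
      rw [kerCoeff, show (2 * (k : ℤ) + 1) = ((2 * k + 1 : ℕ) : ℤ) by push_cast; ring]
      simp only [zpow_natCast]
      field_simp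
      ring
    · refine s2.hasSum.neg.congr_fun fun k => ?_
      rw [show (-((k : ℤ) + 1)) = -1 - k by ring, kerCoeff_reflect hp0 hp,
        show (-1 - (k : ℤ)) = -((k + 1 : ℕ) : ℤ) by push_cast; ring, zpow_neg, zpow_natCast, inv_pow]
      ring
  have n1 := tsum_of_norm_bounded hgeo.hasSum b1
  have n2 := tsum_of_norm_bounded hgeo.hasSum b2
  have e2 := tsum_leg_mul_pow ht
  rw [e, show ∀ A B C D : ℂ, D * (A - B - C) + (1 + p * y) = (D * A + (1 + p * y)) - D * (B + C) by
    intros; ring, e2, neg_add_cancel, zero_sub, norm_neg, norm_mul, mul_comm]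
  gcongr
  exact (norm_add_le _ _).trans (add_le_add n1 n2)

lemma continuousAt_theta {q : ℂ} (hq : ‖q‖ < 1) {y : ℂ} (hy : y ≠ 0) :
    ContinuousAt (fun y => theta y q) y := by
  unfold theta
  exact (continuous_qpoch hq).continuousAt.mul
    ((continuous_qpoch hq).continuousAt.comp (continuousAt_const.div continuousAt_id hy))

/-- The kernel of the pfaffian as a Laurent series. -/
lemma theta_eq_kerSeries {p : ℂ} (hp0 : p ≠ 0) (hp : ‖p‖ < 1) {y : ℂ} (h1 : ‖p‖ < ‖y‖)
    (h2 : ‖p‖ * ‖y‖ < 1) :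
    theta y (p ^ 2) * (theta (p * y) (p ^ 2) * theta (-(p * y)) (p ^ 2)) =
      C2 p * (y * kerSeries p y * theta (p ^ 3 * y ^ 3) (p ^ 6)) := by
  have hn (k : ℕ) (hk : k ≠ 0) : ‖p ^ k‖ < 1 := by
    rw [norm_pow]; exact pow_lt_one₀ (norm_nonneg _) hp hk
  have hpp : 0 < ‖p‖ := norm_pos_iff.2 hp0
  obtain ⟨w, hw3, hw1⟩ : ∃ w : ℂ, w ^ 3 = 1 ∧ w ≠ 1 := by
    have := Complex.isPrimitiveRoot_exp 3 (by norm_num)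
    exact ⟨_, this.pow_eq_one, this.ne_one (by norm_num)⟩
  have hw : 1 + w + w ^ 2 = 0 := by
    have : (w - 1) * (1 + w + w ^ 2) = 0 := by linear_combination hw3
    exact (mul_eq_zero.1 this).resolve_left (sub_ne_zero.2 hw1)
  have hw0 : w ≠ 0 := by rintro rfl; norm_num at hw
  have hwn : ‖w‖ = 1 := norm_eq_one_of_pow_eq_one hw3 (by norm_num)
  have hw2 : 1 - w ^ 2 ≠ 0 := by
    intro h
    have : w ^ 2 = 1 := by linear_combination -h
    exact hw1 (by rw [← hw3, pow_succ, this, one_mul])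
  set y0 := w / p with hy0
  have hy0' : y0 ≠ 0 := div_ne_zero hw0 hp0
  have hpy0 : p * y0 = w := mul_div_cancel₀ _ hp0
  have hR0 := theta_identity hp0 hp hw
  rw [← hy0] at hR0
  set Z := -y0 * (1 - w ^ 2) * qpoch (p ^ 6) (p ^ 6) ^ 2 with hZ
  have hZ0 : Z ≠ 0 := mul_ne_zero (mul_ne_zero (neg_ne_zero.2 hy0') hw2)
    (pow_ne_zero _ (qpoch_ne_zero (hn 6 (by norm_num)) (hn 6 (by norm_num))))
  obtain ⟨α, β, hα, hαβ⟩ := exists_kerSeries_mul_theta hp0 hp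
  have hα0 : α ≠ 0 := hα (numCoeff_zero_ne_zero hp0 hp hy0'
    (by rw [hR0]; exact mul_ne_zero (C2_ne_zero hp) hZ0))
  have hlim0 : Filter.Tendsto (fun s : ℝ => (s : ℂ) * y0) (nhdsWithin 1 (Set.Iio 1)) (nhds y0) := by
    have : Continuous fun s : ℝ => (s : ℂ) * y0 := by fun_prop
    have h := (this.tendsto 1).mono_left (nhdsWithin_le_nhds (s := Set.Iio 1))
    simpa using h
  have hev : ∀ᶠ s : ℝ in nhdsWithin 1 (Set.Iio 1), 1 ≤ ‖(s : ℂ) * y0‖ ∧ ‖p‖ * ‖(s : ℂ) * y0‖ < 1 := by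
    have : Set.Ioo ‖p‖ 1 ∈ nhdsWithin (1 : ℝ) (Set.Iio 1) := Ioo_mem_nhdsLT hp
    filter_upwards [this] with s hs
    have hs0 : 0 < s := hpp.trans hs.1
    rw [norm_mul, Complex.norm_real, Real.norm_of_nonneg hs0.le, hy0, norm_div, hwn]
    constructor
    · rw [mul_one_div, one_le_div hpp]; exact hs.1.le
    · rw [show ‖p‖ * (s * (1 / ‖p‖)) = s by field_simp]; exact hs.2
  have hker : Filter.Tendsto (fun s : ℝ => (1 + p * (s * y0) + (p * (s * y0)) ^ 2) *
      kerSeries p (s * y0)) (nhdsWithin 1 (Set.Iio 1)) (nhds (-(1 + w))) := by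
    obtain ⟨M, hM⟩ := kerSeries_near_pole hp0 hp
    have c1 : Filter.Tendsto (fun s : ℝ => M * ‖1 + p * (s * y0) + (p * (s * y0)) ^ 2‖)
        (nhdsWithin 1 (Set.Iio 1)) (nhds 0) := by
      have : Continuous fun y : ℂ => M * ‖1 + p * y + (p * y) ^ 2‖ := by fun_prop
      have h := (this.tendsto y0).comp hlim0
      rw [hpy0, hw, norm_zero, mul_zero] at h
      exact h
    have c2 : Filter.Tendsto (fun s : ℝ => (1 + p * (s * y0) + (p * (s * y0)) ^ 2) *
      kerSeries p (s * y0) + (1 + p * (s * y0))) (nhdsWithin 1 (Set.Iio 1)) (nhds 0) := by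
      refine squeeze_zero_norm' ?_ c1
      filter_upwards [hev] with s hs
      exact hM _ hs.1 hs.2
    have c3 : Filter.Tendsto (fun s : ℝ => 1 + p * (s * y0)) (nhdsWithin 1 (Set.Iio 1))
        (nhds (1 + w)) := by
      rw [← hpy0]; exact (hlim0.const_mul p).const_add 1
    simpa using c2.sub c3
  have hden : ∀ y : ℂ, y ≠ 0 → theta (p ^ 3 * y ^ 3) (p ^ 6) = (1 - p * y) * (1 + p * y + (p * y) ^ 2) *
      (qpoch (p ^ 9 * y ^ 3) (p ^ 6) * qpoch (p ^ 3 / y ^ 3) (p ^ 6)) := by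
    intro y hy
    rw [theta, qpoch_succ (hn 6 (by norm_num)), show p ^ 6 / (p ^ 3 * y ^ 3) = p ^ 3 / y ^ 3 by
      field_simp, show p ^ 3 * y ^ 3 * p ^ 6 = p ^ 9 * y ^ 3 by ring]
    ring
  have hrest : Filter.Tendsto (fun s : ℝ => (s * y0) * (1 - p * (s * y0)) *
      (qpoch (p ^ 9 * (s * y0) ^ 3) (p ^ 6) * qpoch (p ^ 3 / (s * y0) ^ 3) (p ^ 6)))
      (nhdsWithin 1 (Set.Iio 1)) (nhds (y0 * (1 - w) * (qpoch (p ^ 6) (p ^ 6) * qpoch (p ^ 6) (p ^ 6)))) := by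
    have hc := continuous_qpoch (hn 6 (by norm_num))
    have hcont : ContinuousAt (fun y : ℂ => y * (1 - p * y) *
      (qpoch (p ^ 9 * y ^ 3) (p ^ 6) * qpoch (p ^ 3 / y ^ 3) (p ^ 6))) y0 := by
      have a1 : ContinuousAt (fun y : ℂ => qpoch (p ^ 9 * y ^ 3) (p ^ 6)) y0 := by fun_prop
      have a2 : ContinuousAt (fun y : ℂ => qpoch (p ^ 3 / y ^ 3) (p ^ 6)) y0 :=
        hc.continuousAt.comp (continuousAt_const.div (by fun_prop) (pow_ne_zero _ hy0'))
      exact ContinuousAt.mul (by fun_prop) (a1.mul a2)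
    have h := hcont.tendsto.comp hlim0
    have e1 : p ^ 9 * y0 ^ 3 = p ^ 6 := by
      rw [show p ^ 9 * y0 ^ 3 = p ^ 6 * (p * y0) ^ 3 by ring, hpy0, hw3, mul_one]
    have e2 : p ^ 3 / y0 ^ 3 = p ^ 6 := by
      rw [div_eq_iff (pow_ne_zero _ hy0'), show p ^ 6 * y0 ^ 3 = p ^ 3 * (p * y0) ^ 3 by ring, hpy0,
        hw3, mul_one]
    rw [e1, e2, hpy0] at h
    exact h
  have hL := (hker.mul hrest).const_mul α
  have hRc : ContinuousAt (fun y : ℂ =>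
      theta y (p ^ 2) * (theta (p * y) (p ^ 2) * theta (-(p * y)) (p ^ 2))) y0 := by
    have hc := fun {y : ℂ} (hy : y ≠ 0) => continuousAt_theta (hn 2 (by norm_num)) hy
    have hpy : p * y0 ≠ 0 := mul_ne_zero hp0 hy0'
    exact (hc hy0').mul ((ContinuousAt.comp (hc hpy) (by fun_prop)).mul
      (ContinuousAt.comp (f := fun y : ℂ => -(p * y)) (hc (neg_ne_zero.2 hpy)) (by fun_prop)))
  have hRlim := (hRc.tendsto.comp hlim0).const_mul β
  have heq := tendsto_nhds_unique_of_eventuallyEq hL hRlim (by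
    filter_upwards [hev] with s hs
    have hs0 : (s : ℂ) * y0 ≠ 0 := by
      intro h; rw [h] at hs; norm_num at hs
    have h := hαβ (s * y0) (hp.trans_le hs.1) hs.2
    simp only [Function.comp]
    rw [← h, hden _ hs0]
    ring)
  have hαZ : α * Z = β * (C2 p * Z) := by
    rw [← hR0, ← heq, hZ]; ring
  have hα' : α = β * C2 p := mul_right_cancel₀ hZ0 (by rw [hαZ]; ring)
  have hβ : β ≠ 0 := by rintro rfl; simp at hα'; exact hα0 hα'
  have h := hαβ y h1 h2
  rw [hα'] at h
  exact mul_left_cancel₀ hβ (by rw [← h]; ring)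

/-! ### Pfaffians -/

/-- The bijection `(b, j) ↦ 2 j + b`. -/
def pairEquiv (m : ℕ) : Fin 2 × Fin m ≃ Fin (2 * m) :=
  (Equiv.prodComm _ _).trans (finProdFinEquiv.trans (finCongr (mul_comm m 2)))

lemma pairEquiv_val {m : ℕ} (b : Fin 2) (j : Fin m) : (pairEquiv m (b, j) : ℕ) = 2 * j + b := by
  simp [pairEquiv, finProdFinEquiv, add_comm]

lemma pf_eq {m : ℕ} (A : Matrix (Fin (2 * m)) (Fin (2 * m)) ℂ) :
    pf A = (1 / (2 ^ m * (Nat.factorial m) : ℂ)) *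
      ∑ σ : Equiv.Perm (Fin (2 * m)), ((Equiv.Perm.sign σ : ℤ) : ℂ) *
        ∏ j : Fin m, A (σ (pairEquiv m (0, j))) (σ (pairEquiv m (1, j))) := by
  rw [pf]
  congr 1
  refine Finset.sum_congr rfl fun σ _ => ?_
  congr 1
  refine Finset.prod_congr rfl fun j _ => ?_
  congr 2 <;> · apply Fin.ext; simp [pairEquiv_val]

/-- The square matrix with columns `P (f 0), Q (f 0), P (f 1), Q (f 1), …`. -/
def interleave {m : ℕ} {ι : Type*} (P Q : Fin (2 * m) → ι → ℂ) (f : Fin m → ι) :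
    Matrix (Fin (2 * m)) (Fin (2 * m)) ℂ :=
  Matrix.of fun s l => if ((pairEquiv m).symm l).1 = 0 then P s (f ((pairEquiv m).symm l).2)
    else Q s (f ((pairEquiv m).symm l).2)

lemma pf_sum {m : ℕ} {ι : Type*} [Fintype ι] (P Q : Fin (2 * m) → ι → ℂ) :
    pf (Matrix.of fun s t => ∑ i, P s i * Q t i) = (1 / (2 ^ m * (Nat.factorial m) : ℂ)) *
      ∑ f : Fin m → ι, (interleave P Q f).det := by
  classical
  rw [pf_eq]
  congr 1
  simp only [Matrix.of_apply, Matrix.det_apply', Finset.prod_univ_sum, Fintype.piFinset_univ,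
    Finset.mul_sum]
  rw [Finset.sum_comm]
  refine Finset.sum_congr rfl fun f _ => Finset.sum_congr rfl fun σ _ => ?_
  congr 1
  rw [← (pairEquiv m).prod_comp, Fintype.prod_prod_type, Fin.prod_univ_two, Finset.prod_mul_distrib]
  simp [interleave]

lemma pf_mul_mul_transpose {m : ℕ} (B D : Matrix (Fin (2 * m)) (Fin (2 * m)) ℂ) :
    pf (B * D * B.transpose) = B.det * pf D := by
  have key : ∀ B : Matrix (Fin (2 * m)) (Fin (2 * m)) ℂ, B * D * B.transpose =
      Matrix.of fun s t => ∑ i : Fin (2 * m) × Fin (2 * m), (B s i.1 * D i.1 i.2) * B t i.2 := by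
    intro B
    ext s t
    simp only [Matrix.mul_apply, Matrix.of_apply, Fintype.sum_prod_type, Matrix.transpose_apply,
      Finset.sum_mul]
    exact Finset.sum_comm
  have h1 : pf D = pf (1 * D * Matrix.transpose 1) := by simp
  rw [h1, key, key, pf_sum, pf_sum, mul_left_comm]
  congr 1
  rw [Finset.mul_sum]
  refine Finset.sum_congr rfl fun f _ => ?_
  rw [← Matrix.det_mul]
  congr 1
  ext s l
  simp only [interleave, Matrix.of_apply, Matrix.mul_apply, Matrix.one_apply]
  split_ifs <;> simp

lemma sum_det_submatrix_sq (m : ℕ) :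
    ∑ a : Fin m → Fin m, ((1 : Matrix (Fin m) (Fin m) ℂ).submatrix id a).det ^ 2 =
      (Nat.factorial m : ℂ) := by
  classical
  have h : ∀ a : Fin m → Fin m, ((1 : Matrix (Fin m) (Fin m) ℂ).submatrix id a).det ^ 2 =
      if a ∈ Finset.univ.image (fun σ : Equiv.Perm (Fin m) => (σ : Fin m → Fin m)) then 1 else 0 := by
    intro a
    split_ifs with ha
    · obtain ⟨σ, -, rfl⟩ := Finset.mem_image.1 ha
      rw [Matrix.det_permute', Matrix.det_one, mul_one, ← Int.cast_pow, ← Units.val_pow_eq_pow_val]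
      simp
    · have : ¬ Function.Injective a := fun hi => ha <| Finset.mem_image.2
        ⟨Equiv.ofBijective a (Finite.injective_iff_bijective.1 hi), Finset.mem_univ _, rfl⟩
      obtain ⟨i, j, hij, hne⟩ := Function.not_injective_iff.1 this
      rw [Matrix.det_zero_of_column_eq hne (fun k => by
        rw [Matrix.submatrix_apply, Matrix.submatrix_apply, hij])]
      simp
  simp only [h]
  rw [Finset.sum_ite_mem, Finset.univ_inter, Finset.sum_const,
    Finset.card_image_of_injective _ (DFunLike.coe_injective), Finset.card_univ,
    Fintype.card_perm, Fintype.card_fin]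
  simp

/-- The standard symplectic matrix, with blocks `[[0, 1], [-1, 0]]` along the diagonal. -/
def sympl (m : ℕ) : Matrix (Fin (2 * m)) (Fin (2 * m)) ℂ :=
  Matrix.reindex (pairEquiv m) (pairEquiv m) (Matrix.blockDiagonal fun _ => !![0, 1; -1, 0])

lemma pf_sympl (m : ℕ) : pf (sympl m) = 1 := by
  classical
  let R : Fin 2 → Matrix (Fin 2) (Fin 2) ℂ := ![!![1, 0; 0, 1], !![0, 1; -1, 0]]
  let P (b : Fin 2) (s : Fin (2 * m)) (i : Fin m × Fin 2) : ℂ :=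
    if ((pairEquiv m).symm s).2 = i.1 then R i.2 ((pairEquiv m).symm s).1 b else 0
  have h1 : sympl m = Matrix.of fun s t => ∑ i, P 0 s i * P 1 t i := by
    ext s t
    obtain ⟨⟨b, j⟩, rfl⟩ := (pairEquiv m).surjective s
    obtain ⟨⟨c, k⟩, rfl⟩ := (pairEquiv m).surjective t
    simp only [sympl, P, Matrix.reindex_apply, Matrix.submatrix_apply, Equiv.symm_apply_apply,
      Matrix.blockDiagonal_apply, Matrix.of_apply, Fintype.sum_prod_type, Fin.sum_univ_two]
    rw [Finset.sum_add_distrib]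
    by_cases hjk : j = k
    · subst hjk
      fin_cases b <;> fin_cases c <;> simp [R]
    · simp [hjk]
  have h2 : ∀ f : Fin m → Fin m × Fin 2, (interleave (P 0) (P 1) f).det =
      ((1 : Matrix (Fin m) (Fin m) ℂ).submatrix id (fun j => (f j).1)).det ^ 2 := by
    intro f
    have h3 : interleave (P 0) (P 1) f = Matrix.reindex (pairEquiv m) (pairEquiv m)
        (Matrix.kroneckerMap (· * ·) (1 : Matrix (Fin 2) (Fin 2) ℂ)
          ((1 : Matrix (Fin m) (Fin m) ℂ).submatrix id (fun j => (f j).1)) *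
        Matrix.blockDiagonal fun j => R (f j).2) := by
      ext s t
      obtain ⟨⟨b, j⟩, rfl⟩ := (pairEquiv m).surjective s
      obtain ⟨⟨c, k⟩, rfl⟩ := (pairEquiv m).surjective t
      simp only [interleave, P, Matrix.reindex_apply, Matrix.submatrix_apply,
        Equiv.symm_apply_apply, Matrix.of_apply, Matrix.mul_apply, Matrix.kroneckerMap_apply,
        Matrix.blockDiagonal_apply, Fintype.sum_prod_type, Matrix.one_apply, id]
      simp only [ite_mul, one_mul, zero_mul, mul_ite, mul_zero, Finset.sum_ite_eq', Finset.mem_univ,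
        if_true]
      fin_cases b <;> fin_cases c <;> simp
    rw [h3, Matrix.det_reindex_self, Matrix.det_mul, Matrix.det_kronecker, Matrix.det_blockDiagonal,
      Finset.prod_eq_one, Matrix.det_one]
    · simp
    · intro j _
      generalize (f j).2 = b
      fin_cases b <;> simp [R, Matrix.det_fin_two]
  rw [h1, pf_sum]
  simp only [h2]
  rw [← (Equiv.arrowProdEquivProdArrow (Fin m) (fun _ => Fin m) (fun _ => Fin 2)).symm.sum_comp,
    Fintype.sum_prod_type_right]
  simp only [Equiv.arrowProdEquivProdArrow, Equiv.coe_fn_symm_mk, sum_det_submatrix_sq]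
  have := Nat.factorial_ne_zero m
  simp
  field_simp

lemma pf_checkerboard {m : ℕ} (H : Matrix (Fin m) (Fin m) ℂ)
    (A : Matrix (Fin (2 * m)) (Fin (2 * m)) ℂ)
    (h00 : ∀ i j, A (pairEquiv m (0, i)) (pairEquiv m (0, j)) = 0)
    (h01 : ∀ i j, A (pairEquiv m (0, i)) (pairEquiv m (1, j)) = H i j)
    (h10 : ∀ i j, A (pairEquiv m (1, i)) (pairEquiv m (0, j)) = -H j i)
    (h11 : ∀ i j, A (pairEquiv m (1, i)) (pairEquiv m (1, j)) = 0) : pf A = H.det := by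
  classical
  let B : Matrix (Fin (2 * m)) (Fin (2 * m)) ℂ := Matrix.reindex (pairEquiv m) (pairEquiv m)
    (Matrix.of fun s t => if s.1 = t.1 then ![H, 1] s.1 s.2 t.2 else 0)
  have hB : B.det = H.det := by
    have : (Matrix.of fun s t : Fin 2 × Fin m => if s.1 = t.1 then ![H, 1] s.1 s.2 t.2 else 0) =
        Matrix.reindex (Equiv.prodComm _ _) (Equiv.prodComm _ _) (Matrix.blockDiagonal ![H, 1]) := by
      ext s t
      simp [Matrix.blockDiagonal_apply]
    rw [Matrix.det_reindex_self, this, Matrix.det_reindex_self, Matrix.det_blockDiagonal]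
    simp
  have hA : A = B * sympl m * B.transpose := by
    ext s t
    obtain ⟨⟨b, j⟩, rfl⟩ := (pairEquiv m).surjective s
    obtain ⟨⟨c, k⟩, rfl⟩ := (pairEquiv m).surjective t
    simp only [B, sympl, Matrix.reindex_apply, Matrix.mul_apply, ← (pairEquiv m).sum_comp,
      Matrix.submatrix_apply, Matrix.transpose_apply, Equiv.symm_apply_apply,
      Matrix.blockDiagonal_apply, Fintype.sum_prod_type, Matrix.of_apply, Fin.sum_univ_two]
    fin_cases b <;> fin_cases c <;> simp [h00, h01, h10, h11, Matrix.one_apply]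
  rw [hA, pf_mul_mul_transpose, pf_sympl, mul_one, hB]

/-! ### Divided differences of the exponential function -/

/-- The divided difference of `ζ ↦ exp (α ζ)` at the nodes `w 0, …, w s`, as a contour integral. -/
def divDiff (R : ℝ) (w : ℕ → ℂ) (α : ℂ) (s : ℕ) : ℂ :=
  (2 * Real.pi * I : ℂ)⁻¹ •
    circleIntegral (fun ζ => exp (α * ζ) * ∏ l ∈ Finset.range (s + 1), (ζ - w l)⁻¹) 0 R

lemma norm_inv_sub_le {R : ℝ} (hR : 0 < R) {w ζ : ℂ} (hw : ‖w‖ ≤ R / 2)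
    (hζ : ζ ∈ Metric.sphere (0 : ℂ) R) : ‖(ζ - w)⁻¹‖ ≤ 2 / R := by
  have h1 : ‖ζ‖ = R := by simpa using hζ
  have h2 : R / 2 ≤ ‖ζ - w‖ := by
    have := norm_sub_norm_le ζ w
    linarith
  rw [norm_inv, show 2 / R = (R / 2)⁻¹ by rw [inv_div]]
  exact inv_anti₀ (by positivity) h2

lemma sub_ne_zero_of_mem_sphere {R : ℝ} (hR : 0 < R) {w ζ : ℂ} (hw : ‖w‖ ≤ R / 2)
    (hζ : ζ ∈ Metric.sphere (0 : ℂ) R) : ζ - w ≠ 0 := by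
  have h1 : ‖ζ‖ = R := by simpa using hζ
  intro h
  rw [← sub_eq_zero.1 h] at hw
  linarith

lemma norm_divDiff_integrand_le {R : ℝ} (hR : 0 < R) {w : ℕ → ℂ} (hw : ∀ l, ‖w l‖ ≤ R / 2) (α : ℂ)
    (s : ℕ) {ζ : ℂ} (hζ : ζ ∈ Metric.sphere (0 : ℂ) R) :
    ‖exp (α * ζ) * ∏ l ∈ Finset.range (s + 1), (ζ - w l)⁻¹‖ ≤
      Real.exp (‖α‖ * R) * (2 / R) ^ (s + 1) := by
  have h1 : ‖ζ‖ = R := by simpa using hζ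
  rw [norm_mul, norm_prod]
  gcongr
  · rw [← h1, ← norm_mul]; exact norm_exp_le_exp_norm _
  · calc _ ≤ ∏ l ∈ Finset.range (s + 1), 2 / R :=
          Finset.prod_le_prod (fun _ _ => norm_nonneg _) fun l _ => norm_inv_sub_le hR (hw l) hζ
      _ = _ := by rw [Finset.prod_const, Finset.card_range]

lemma norm_divDiff_le {R : ℝ} (hR : 0 < R) {w : ℕ → ℂ} (hw : ∀ l, ‖w l‖ ≤ R / 2) (α : ℂ) (s : ℕ) :
    ‖divDiff R w α s‖ ≤ R * (Real.exp (‖α‖ * R) * (2 / R) ^ (s + 1)) :=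
  circleIntegral.norm_two_pi_i_inv_smul_integral_le_of_norm_le_const hR.le
    fun _ hζ => norm_divDiff_integrand_le hR hw α s hζ

lemma continuousOn_divDiff_integrand {R : ℝ} (hR : 0 < R) {w : ℕ → ℂ} (hw : ∀ l, ‖w l‖ ≤ R / 2)
    (α : ℂ) (s : ℕ) :
    ContinuousOn (fun ζ => exp (α * ζ) * ∏ l ∈ Finset.range (s + 1), (ζ - w l)⁻¹)
      (Metric.sphere 0 R) := by
  refine ContinuousOn.mul (by fun_prop) (continuousOn_finsetProd _ fun l _ => ?_)
  exact (by fun_prop : ContinuousOn (fun ζ : ℂ => ζ - w l) _).inv₀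
    fun ζ hζ => sub_ne_zero_of_mem_sphere hR (hw l) hζ

lemma inv_sub_eq_newton {w : ℕ → ℂ} {ζ x : ℂ} (hx : ζ - x ≠ 0) (hw : ∀ l, ζ - w l ≠ 0) (M : ℕ) :
    (ζ - x)⁻¹ = (∑ s ∈ Finset.range M, (∏ r ∈ Finset.range s, (x - w r)) *
        ∏ r ∈ Finset.range (s + 1), (ζ - w r)⁻¹) +
      (∏ r ∈ Finset.range M, (x - w r)) * (∏ r ∈ Finset.range M, (ζ - w r)⁻¹) * (ζ - x)⁻¹ := by
  induction M with
  | zero => simp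
  | succ M ih =>
    rw [Finset.sum_range_succ, Finset.prod_range_succ, Finset.prod_range_succ, add_assoc]
    refine ih.trans ?_
    have h := hw M
    have key : (ζ - x)⁻¹ = (ζ - w M)⁻¹ + (x - w M) * (ζ - w M)⁻¹ * (ζ - x)⁻¹ := by
      field_simp
      ring
    congr 1
    linear_combination (∏ r ∈ Finset.range M, (x - w r)) * (∏ r ∈ Finset.range M, (ζ - w r)⁻¹) * key

lemma exp_eq_newton {R : ℝ} (hR : 0 < R) {w : ℕ → ℂ} (hw : ∀ l, ‖w l‖ ≤ R / 2) (α : ℂ) {N i : ℕ}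
    (hi : i < N) : exp (α * w i) =
      ∑ s ∈ Finset.range N, (∏ r ∈ Finset.range s, (w i - w r)) * divDiff R w α s := by
  have hball : w i ∈ Metric.ball (0 : ℂ) R := by
    rw [mem_ball_zero_iff]; linarith [hw i]
  have h1 := (DifferentiableOn.circleIntegral_sub_inv_smul (f := fun ζ => exp (α * ζ)) (c := 0)
    (R := R) (by fun_prop) hball)
  have h2 : circleIntegral (fun ζ => (ζ - w i)⁻¹ • exp (α * ζ)) 0 R =
      circleIntegral (fun ζ => ∑ s ∈ Finset.range N, (∏ r ∈ Finset.range s, (w i - w r)) *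
        (exp (α * ζ) * ∏ l ∈ Finset.range (s + 1), (ζ - w l)⁻¹)) 0 R := by
    refine circleIntegral.integral_congr hR.le fun ζ hζ => ?_
    have h3 := inv_sub_eq_newton (sub_ne_zero_of_mem_sphere hR (hw i) hζ)
      (fun l => sub_ne_zero_of_mem_sphere hR (hw l) hζ) N
    rw [Finset.prod_eq_zero (Finset.mem_range.2 hi) (sub_self (w i)), zero_mul, zero_mul,
      add_zero] at h3
    simp only [smul_eq_mul]
    rw [h3, Finset.sum_mul]
    exact Finset.sum_congr rfl fun s _ => by ring
  have h4 : ∀ s ∈ Finset.range N, CircleIntegrable (fun ζ => (∏ r ∈ Finset.range s, (w i - w r)) *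
      (exp (α * ζ) * ∏ l ∈ Finset.range (s + 1), (ζ - w l)⁻¹)) 0 R := fun s _ =>
    (continuousOn_const.mul (continuousOn_divDiff_integrand hR hw α s)).circleIntegrable hR.le
  rw [h2, circleIntegral.integral_fun_sum h4] at h1
  simp only [circleIntegral.integral_const_mul] at h1
  simp only [divDiff, mul_smul_comm]
  rw [← Finset.smul_sum, h1, inv_smul_smul₀ two_pi_I_ne_zero]

lemma divDiff_zero {R : ℝ} (hR : 0 < R) (α : ℂ) (s : ℕ) :
    divDiff R 0 α s = α ^ s / (Nat.factorial s : ℂ) := by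
  have h1 := DifferentiableOn.circleIntegral_one_div_sub_center_pow_smul (c := 0)
    (f := fun ζ => exp (α * ζ)) hR s (by fun_prop)
  rw [iteratedDeriv_cexp_const_mul] at h1
  have h2 : (fun ζ : ℂ => exp (α * ζ) * ∏ l ∈ Finset.range (s + 1), (ζ - (0 : ℕ → ℂ) l)⁻¹) =
      fun ζ => (1 / (ζ - 0) ^ (s + 1)) • exp (α * ζ) := by
    funext ζ
    simp [mul_comm]
  rw [divDiff, h2, h1]
  have := two_pi_I_ne_zero
  simp only [smul_eq_mul, mul_zero, exp_zero, mul_one]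
  field_simp

lemma tendsto_divDiff {R : ℝ} (hR : 0 < R) {X : Type*} {F : Filter X} [F.IsCountablyGenerated]
    {w : X → ℕ → ℂ} (hw : ∀ᶠ x in F, ∀ l, ‖w x l‖ ≤ R / 2)
    (h0 : ∀ l, Filter.Tendsto (fun x => w x l) F (nhds 0)) (α : ℂ) (s : ℕ) :
    Filter.Tendsto (fun x => divDiff R (w x) α s) F (nhds (α ^ s / (Nat.factorial s : ℂ))) := by
  rw [← divDiff_zero hR]
  refine Filter.Tendsto.const_smul ?_ _
  have hmem : ∀ θ, circleMap 0 R θ ∈ Metric.sphere (0 : ℂ) R := circleMap_mem_sphere 0 hR.le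
  refine intervalIntegral.tendsto_integral_filter_of_dominated_convergence
    (fun _ => R * (Real.exp (‖α‖ * R) * (2 / R) ^ (s + 1))) ?_ ?_ (by simp) ?_
  · filter_upwards [hw] with x hx
    refine Continuous.aestronglyMeasurable ?_
    have hd : Continuous (deriv (circleMap 0 R)) := by
      rw [show deriv (circleMap 0 R) = fun θ => circleMap 0 R θ * I from funext (deriv_circleMap 0 R)]
      fun_prop
    exact hd.smul ((continuousOn_divDiff_integrand hR hx α s).comp_continuous (continuous_circleMap 0 R) hmem)
  · filter_upwards [hw] with x hx
    refine Filter.Eventually.of_forall fun θ _ => ?_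
    rw [norm_smul, deriv_circleMap, norm_mul, norm_circleMap_zero, norm_I, mul_one, abs_of_pos hR]
    gcongr
    exact norm_divDiff_integrand_le hR hx α s (hmem θ)
  · refine Filter.Eventually.of_forall fun θ _ => ?_
    refine Filter.Tendsto.const_smul (Filter.Tendsto.const_mul _ (tendsto_finsetProd _ fun l _ => ?_)) _
    refine (Filter.Tendsto.const_sub _ (h0 l)).inv₀ ?_
    exact sub_ne_zero_of_mem_sphere hR (by simpa using by positivity) (hmem θ)

/-! ### Confluent limits of pfaffians -/

/-- Extend a finite tuple by zeros. -/
def nodes {N : ℕ} (z : Fin N → ℂ) (l : ℕ) : ℂ := if h : l < N then z ⟨l, h⟩ else 0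

lemma nodes_val {N : ℕ} (z : Fin N → ℂ) (i : Fin N) : nodes z i = z i := by
  simp [nodes]

lemma norm_nodes_le {N : ℕ} (z : Fin N → ℂ) (l : ℕ) : ‖nodes z l‖ ≤ ‖z‖ := by
  unfold nodes
  split_ifs
  · exact norm_le_pi_norm z _
  · simp

lemma tendsto_nodes {N : ℕ} (l : ℕ) :
    Filter.Tendsto (fun z : Fin N → ℂ => nodes z l) (nhds 0) (nhds 0) := by
  refine squeeze_zero_norm (fun z => norm_nodes_le z l) ?_
  simpa using (continuous_norm (E := Fin N → ℂ)).tendsto 0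

lemma continuous_pf {m : ℕ} :
    Continuous fun A : Matrix (Fin (2 * m)) (Fin (2 * m)) ℂ => pf A := by
  unfold pf
  refine continuous_const.mul (continuous_finsetSum _ fun σ _ => continuous_const.mul ?_)
  exact continuous_finsetProd _ fun j _ => continuous_apply_apply _ _

lemma prod_pairs_eq {M : Type*} [CommMonoid M] {N : ℕ} (f : Fin N → Fin N → M) :
    (∏ i, ∏ j, if i < j then f i j else 1) = ∏ j, ∏ i ∈ Finset.Iio j, f i j := by
  rw [Finset.prod_comm]
  refine Finset.prod_congr rfl fun j _ => ?_
  rw [← Finset.prod_filter]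
  congr 1
  ext i
  simp

lemma prod_Iio_eq_prod_range {M : Type*} [CommMonoid M] {N : ℕ} (j : Fin N) (f : ℕ → M) :
    ∏ i ∈ Finset.Iio j, f i = ∏ i ∈ Finset.range j, f i := by
  refine Finset.prod_bij (fun i _ => (i : ℕ)) (fun i hi => by simpa using hi)
    (fun a _ b _ h => Fin.ext h) (fun b hb => ?_) (fun _ _ => rfl)
  exact ⟨⟨b, (Finset.mem_range.1 hb).trans j.isLt⟩, by simpa [Fin.lt_def] using hb, rfl⟩

lemma prod_pairs_const {M : Type*} [CommMonoid M] (m : ℕ) (c : M) :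
    (∏ i : Fin (2 * m), ∏ j : Fin (2 * m), if i < j then c else 1) = c ^ (m * (2 * m - 1)) := by
  rw [prod_pairs_eq]
  simp only [prod_Iio_eq_prod_range (f := fun _ => c), Finset.prod_const, Finset.card_range]
  rw [Finset.prod_pow_eq_pow_sum, Fin.sum_univ_eq_sum_range (fun j => j), Finset.sum_range_id,
    mul_assoc, Nat.mul_div_cancel_left _ two_pos]

/-- The lower triangular matrix of Newton's interpolation formula. -/
def newtonMatrix {N : ℕ} (z : Fin N → ℂ) : Matrix (Fin N) (Fin N) ℂ :=
  Matrix.of fun i s => ∏ r ∈ Finset.range s, (nodes z i - nodes z r)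

lemma det_newtonMatrix {m : ℕ} (z : Fin (2 * m) → ℂ) :
    (newtonMatrix z).det = (-1) ^ m * ∏ i, ∏ j, if i < j then z i - z j else 1 := by
  have hs : (-1 : ℂ) ^ m = (-1) ^ (m * (2 * m - 1)) := by
    rcases m with _ | m
    · simp
    rw [pow_mul, show 2 * (m + 1) - 1 = 2 * m + 1 by omega, ← pow_mul, mul_comm, pow_mul]
    simp [pow_succ, pow_mul]
  have ht : (newtonMatrix z).BlockTriangular OrderDual.toDual := by
    intro i s his
    rw [newtonMatrix, Matrix.of_apply]
    exact Finset.prod_eq_zero (i := (i : ℕ)) (by simpa using his) (sub_self _)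
  rw [Matrix.det_of_isLowerTriangular _ ht, hs, ← prod_pairs_const, prod_pairs_eq, prod_pairs_eq,
    ← Finset.prod_mul_distrib]
  refine Finset.prod_congr rfl fun j _ => ?_
  rw [newtonMatrix, Matrix.of_apply, ← Finset.prod_mul_distrib,
    ← prod_Iio_eq_prod_range j fun r => nodes z j - nodes z r]
  refine Finset.prod_congr rfl fun i _ => ?_
  rw [nodes_val, nodes_val]
  ring

section Confluent

variable {ι : Type*} {c a : ι → ℂ} {R : ℝ}

lemma norm_divDiff_mul_le (hR : 0 < R) {w : ℕ → ℂ} (hw : ∀ l, ‖w l‖ ≤ R / 2) (s t : ℕ) (k : ι) :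
    ‖c k * (divDiff R w (a k) s * divDiff R w (-a k) t)‖ ≤
      (R * (2 / R) ^ (s + 1) * (R * (2 / R) ^ (t + 1))) * (‖c k‖ * Real.exp (2 * R * ‖a k‖)) := by
  rw [norm_mul, norm_mul]
  have h1 := norm_divDiff_le hR hw (a k) s
  have h2 := norm_divDiff_le hR hw (-a k) t
  rw [norm_neg] at h2
  calc _ ≤ ‖c k‖ * ((R * (Real.exp (‖a k‖ * R) * (2 / R) ^ (s + 1))) *
        (R * (Real.exp (‖a k‖ * R) * (2 / R) ^ (t + 1)))) := by gcongr
    _ = _ := by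
      rw [show 2 * R * ‖a k‖ = ‖a k‖ * R + ‖a k‖ * R by ring, Real.exp_add]
      ring

lemma summable_divDiff_mul (hs : Summable fun k => ‖c k‖ * Real.exp (2 * R * ‖a k‖)) (hR : 0 < R)
    {w : ℕ → ℂ} (hw : ∀ l, ‖w l‖ ≤ R / 2) (s t : ℕ) :
    Summable fun k => c k * (divDiff R w (a k) s * divDiff R w (-a k) t) :=
  .of_norm_bounded (hs.mul_left _) fun k => norm_divDiff_mul_le hR hw s t k

lemma expKernel_eq (hs : Summable fun k => ‖c k‖ * Real.exp (2 * R * ‖a k‖)) (hR : 0 < R) {N : ℕ}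
    {z : Fin N → ℂ} (hz : ‖z‖ ≤ R / 2) :
    (Matrix.of fun i j => ∑' k, c k * (exp (a k * z i) * exp (-a k * z j))) =
      newtonMatrix z * (Matrix.of fun s t : Fin N =>
        ∑' k, c k * (divDiff R (nodes z) (a k) s * divDiff R (nodes z) (-a k) t)) *
      (newtonMatrix z).transpose := by
  have hw : ∀ l, ‖nodes z l‖ ≤ R / 2 := fun l => (norm_nodes_le z l).trans hz
  have hexp : ∀ (α : ℂ) (i : Fin N), exp (α * z i) =
      ∑ s : Fin N, newtonMatrix z i s * divDiff R (nodes z) α s := by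
    intro α i
    rw [← nodes_val z i, exp_eq_newton hR hw α i.isLt, ← Fin.sum_univ_eq_sum_range
      (fun s => (∏ r ∈ Finset.range s, (nodes z i - nodes z r)) * divDiff R (nodes z) α s)]
    rfl
  have hsm := summable_divDiff_mul hs hR hw
  ext i j
  simp only [Matrix.of_apply, Matrix.mul_apply, Matrix.transpose_apply, hexp]
  have h1 : ∀ k, c k * ((∑ s : Fin N, newtonMatrix z i s * divDiff R (nodes z) (a k) s) *
      ∑ t : Fin N, newtonMatrix z j t * divDiff R (nodes z) (-a k) t) =
      ∑ t : Fin N, ∑ s : Fin N, newtonMatrix z i s * newtonMatrix z j t *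
        (c k * (divDiff R (nodes z) (a k) s * divDiff R (nodes z) (-a k) t)) := by
    intro k
    rw [Finset.sum_mul_sum, Finset.mul_sum, Finset.sum_comm]
    refine Finset.sum_congr rfl fun s _ => ?_
    rw [Finset.mul_sum]
    exact Finset.sum_congr rfl fun t _ => by ring
  simp only [h1]
  have h2 : ∀ s t : Fin N, Summable fun k => newtonMatrix z i s * newtonMatrix z j t *
      (c k * (divDiff R (nodes z) (a k) s * divDiff R (nodes z) (-a k) t)) :=
    fun s t => (hsm s t).mul_left _
  refine (Summable.tsum_finsetSum fun t _ => summable_sum fun s _ => h2 s t).trans ?_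
  refine Finset.sum_congr rfl fun t _ => ?_
  refine (Summable.tsum_finsetSum fun s _ => h2 s t).trans ?_
  rw [Finset.sum_mul]
  refine Finset.sum_congr rfl fun s _ => ?_
  rw [tsum_mul_left]
  ring

lemma tendsto_pf_expKernel (hs : Summable fun k => ‖c k‖ * Real.exp (2 * R * ‖a k‖)) (hR : 0 < R)
    (m : ℕ) :
    Filter.Tendsto (fun z : Fin (2 * m) → ℂ =>
      pf (Matrix.of fun i j => ∑' k, c k * (exp (a k * z i) * exp (-a k * z j))) /
        ∏ i, ∏ j, if i < j then z i - z j else 1)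
      (nhdsWithin 0 {z : Fin (2 * m) → ℂ | Function.Injective z})
      (nhds ((-1) ^ m * pf (Matrix.of fun s t : Fin (2 * m) => ∑' k, c k *
        (a k ^ (s : ℕ) / (Nat.factorial s : ℂ) * ((-a k) ^ (t : ℕ) / (Nat.factorial t : ℂ)))))) := by
  have hsmall : ∀ᶠ z : Fin (2 * m) → ℂ in nhds 0, ‖z‖ ≤ R / 2 := by
    have := (continuous_norm (E := Fin (2 * m) → ℂ)).tendsto 0
    rw [norm_zero] at this
    exact this.eventually_le_const (by positivity)
  have hw : ∀ᶠ z : Fin (2 * m) → ℂ in nhds 0, ∀ l, ‖nodes z l‖ ≤ R / 2 := by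
    filter_upwards [hsmall] with z hz l using (norm_nodes_le z l).trans hz
  have hlim : Filter.Tendsto (fun z : Fin (2 * m) → ℂ => (-1) ^ m * pf (Matrix.of fun s t : Fin (2 * m) =>
      ∑' k, c k * (divDiff R (nodes z) (a k) s * divDiff R (nodes z) (-a k) t))) (nhds 0)
      (nhds ((-1) ^ m * pf (Matrix.of fun s t : Fin (2 * m) => ∑' k, c k *
        (a k ^ (s : ℕ) / (Nat.factorial s : ℂ) * ((-a k) ^ (t : ℕ) / (Nat.factorial t : ℂ)))))) := by
    refine ((continuous_pf.tendsto _).comp ?_).const_mul _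
    refine tendsto_pi_nhds.2 fun s => tendsto_pi_nhds.2 fun t => ?_
    refine tendsto_tsum_of_dominated_convergence (hs.mul_left
      (R * (2 / R) ^ ((s : ℕ) + 1) * (R * (2 / R) ^ ((t : ℕ) + 1)))) (fun k => ?_) ?_
    · exact ((tendsto_divDiff hR hw tendsto_nodes _ _).mul
        (tendsto_divDiff hR hw tendsto_nodes _ _)).const_mul _
    · filter_upwards [hw] with z hz k using norm_divDiff_mul_le hR hz s t k
  refine (hlim.mono_left nhdsWithin_le_nhds).congr' ?_
  filter_upwards [self_mem_nhdsWithin, nhdsWithin_le_nhds hsmall] with z hinj hz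
  have hne : (∏ i, ∏ j, if i < j then z i - z j else 1) ≠ 0 := by
    refine Finset.prod_ne_zero_iff.2 fun i _ => Finset.prod_ne_zero_iff.2 fun j _ => ?_
    split_ifs with hij
    · exact sub_ne_zero.2 fun h => hij.ne (hinj h)
    · exact one_ne_zero
  rw [expKernel_eq hs hR hz, pf_mul_mul_transpose, det_newtonMatrix]
  field_simp

end Confluent

/-! ### Moments of the kernel -/

/-- The exponents in the expansion of the kernel as a sum of exponentials. -/
def freq (k : ℤ) : ℂ := Real.pi * I * (2 * k + 1)

lemma norm_freq_le (k : ℤ) : ‖freq k‖ ≤ Real.pi * (2 * |(k : ℝ)| + 1) := by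
  rw [freq, norm_mul, norm_mul, norm_I, mul_one, norm_real, Real.norm_of_nonneg Real.pi_pos.le]
  gcongr
  refine (norm_add_le _ _).trans ?_
  simp [norm_intCast]

lemma exists_summable_kerCoeff_exp {p : ℂ} (hp0 : p ≠ 0) (hp : ‖p‖ < 1) :
    ∃ R : ℝ, 0 < R ∧ Summable fun k : ℤ => ‖kerCoeff p k‖ * Real.exp (2 * R * ‖freq k‖) := by
  obtain ⟨t, ht⟩ : ∃ t, ‖p‖ = Real.exp (-t) :=
    ⟨-Real.log ‖p‖, by rw [neg_neg, Real.exp_log (norm_pos_iff.2 hp0)]⟩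
  have ht0 : 0 < t := by
    rw [ht, Real.exp_lt_one_iff] at hp; linarith
  have key : ∀ u : ℝ, |u| < t → Summable fun k : ℤ => ‖kerCoeff p k‖ * Real.exp (u * k) := by
    intro u hu
    obtain ⟨hu1, hu2⟩ := abs_lt.1 hu
    have hn : ‖(Real.exp u : ℂ)‖ = Real.exp u := by
      rw [norm_real, Real.norm_of_nonneg (Real.exp_pos u).le]
    have := summable_kerCoeff hp0 hp (y := (Real.exp u : ℂ))
      (by rw [hn, ht, Real.exp_lt_exp]; exact hu1)
      (by rw [hn, ht, ← Real.exp_add, Real.exp_lt_one_iff]; linarith)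
    refine this.congr fun k => ?_
    rw [norm_mul, norm_zpow, hn, Real.exp_mul, Real.rpow_intCast]
  have hpi := Real.pi_pos
  refine ⟨t / (8 * Real.pi), by positivity, ?_⟩
  refine Summable.of_nonneg_of_le (fun _ => by positivity) (fun k => ?_)
    (((key (t / 2) (by rw [abs_lt]; constructor <;> linarith)).add
      (key (-(t / 2)) (by rw [abs_lt]; constructor <;> linarith))).mul_left (Real.exp (t / 4)))
  have h1 : 2 * (t / (8 * Real.pi)) * ‖freq k‖ ≤ t / 4 + t / 2 * |(k : ℝ)| := by
    calc _ ≤ 2 * (t / (8 * Real.pi)) * (Real.pi * (2 * |(k : ℝ)| + 1)) := by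
          gcongr; exact norm_freq_le k
      _ = _ := by field_simp; ring
  have h2 : Real.exp (t / 2 * |(k : ℝ)|) ≤ Real.exp (t / 2 * k) + Real.exp (-(t / 2) * k) := by
    rcases abs_cases (k : ℝ) with ⟨h, -⟩ | ⟨h, -⟩ <;> rw [h]
    · linarith [Real.exp_pos (-(t / 2) * k)]
    · rw [mul_neg, ← neg_mul]; linarith [Real.exp_pos (t / 2 * k)]
  calc _ ≤ ‖kerCoeff p k‖ * (Real.exp (t / 4) * (Real.exp (t / 2 * k) + Real.exp (-(t / 2) * k))) := by
        gcongr
        refine (Real.exp_le_exp.2 h1).trans ?_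
        rw [Real.exp_add]
        gcongr
    _ = _ := by ring

/-- The moments of the kernel. -/
def moment (p : ℂ) (m : ℕ) : ℂ := ∑' k : ℤ, kerCoeff p k * (2 * k + 1) ^ m

lemma summable_moment {p : ℂ} (hp0 : p ≠ 0) (hp : ‖p‖ < 1) (m : ℕ) :
    Summable fun k : ℤ => kerCoeff p k * (2 * (k : ℂ) + 1) ^ m := by
  obtain ⟨R, hR, hs⟩ := exists_summable_kerCoeff_exp hp0 hp
  have hpi := Real.pi_pos
  refine Summable.of_norm_bounded (hs.mul_left (m.factorial / (2 * R * Real.pi) ^ m)) fun k => ?_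
  have h1 := Real.pow_div_factorial_le_exp (2 * R * ‖freq k‖) (by positivity) m
  have h2 : ‖freq k‖ = Real.pi * ‖2 * (k : ℂ) + 1‖ := by
    rw [freq, norm_mul, norm_mul, norm_I, mul_one, norm_real, Real.norm_of_nonneg hpi.le]
  rw [norm_mul, norm_pow]
  rw [div_le_iff₀ (by positivity)] at h1
  have h3 : ‖2 * (k : ℂ) + 1‖ ^ m ≤ m.factorial / (2 * R * Real.pi) ^ m * Real.exp (2 * R * ‖freq k‖) := by
    rw [div_mul_eq_mul_div, le_div_iff₀ (by positivity), ← mul_pow]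
    calc _ = (2 * R * ‖freq k‖) ^ m := by rw [h2]; ring
      _ ≤ _ := h1.trans_eq (mul_comm _ _)
  calc _ ≤ ‖kerCoeff p k‖ * (m.factorial / (2 * R * Real.pi) ^ m * Real.exp (2 * R * ‖freq k‖)) := by
        gcongr
    _ = _ := by ring

lemma kerCoeff_mul_reflect {p : ℂ} (hp0 : p ≠ 0) (hp : ‖p‖ < 1) (m : ℕ) (k : ℤ) :
    kerCoeff p (-1 - k) * (2 * ((-1 - k : ℤ) : ℂ) + 1) ^ m =
      (-1) ^ (m + 1) * (kerCoeff p k * (2 * (k : ℂ) + 1) ^ m) := by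
  rw [kerCoeff_reflect hp0 hp, show 2 * ((-1 - k : ℤ) : ℂ) + 1 = -1 * (2 * (k : ℂ) + 1) by
    push_cast; ring, mul_pow]
  ring

lemma moment_even {p : ℂ} (hp0 : p ≠ 0) (hp : ‖p‖ < 1) {m : ℕ} (hm : Even m) : moment p m = 0 := by
  have h : moment p m = (-1) ^ (m + 1) * moment p m := by
    conv_lhs => rw [moment, ← (Equiv.subLeft (-1 : ℤ)).tsum_eq]
    rw [moment, ← tsum_mul_left]
    exact tsum_congr fun k => kerCoeff_mul_reflect hp0 hp m k
  rw [hm.add_one.neg_one_pow] at h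
  linear_combination h / 2

lemma moment_odd {p : ℂ} (hp0 : p ≠ 0) (hp : ‖p‖ < 1) (j : ℕ) :
    moment p (2 * j + 1) = 2 * L2 p j := by
  have hs := summable_moment hp0 hp (2 * j + 1)
  have h1 : ∀ k : ℕ, kerCoeff p (k : ℤ) * (2 * ((k : ℤ) : ℂ) + 1) ^ (2 * j + 1) =
      (leg ((k : ℤ) + 2) : ℂ) * (p ^ k / (1 + p ^ (2 * k + 1))) * (2 * (k : ℂ) + 1) ^ (2 * j + 1) := by
    intro k
    rw [kerCoeff, show 2 * (k : ℤ) + 1 = ((2 * k + 1 : ℕ) : ℤ) by push_cast; ring, zpow_natCast,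
      zpow_natCast, Int.cast_natCast]
  have h2 : ∀ k : ℕ, kerCoeff p (-((k : ℤ) + 1)) * (2 * ((-((k : ℤ) + 1) : ℤ) : ℂ) + 1) ^ (2 * j + 1) =
      kerCoeff p (k : ℤ) * (2 * ((k : ℤ) : ℂ) + 1) ^ (2 * j + 1) := by
    intro k
    rw [show -((k : ℤ) + 1) = -1 - k by ring, kerCoeff_mul_reflect hp0 hp,
      (show Even (2 * j + 1 + 1) from ⟨j + 1, by ring⟩).neg_one_pow, one_mul]
  have hn : Summable fun k : ℕ => kerCoeff p (k : ℤ) * (2 * ((k : ℤ) : ℂ) + 1) ^ (2 * j + 1) :=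
    hs.comp_injective Nat.cast_injective
  rw [moment, tsum_of_nat_of_neg_add_one (f := fun k : ℤ => kerCoeff p k * (2 * (k : ℂ) + 1) ^ (2 * j + 1))
    hn (hn.congr fun k => (h2 k).symm)]
  simp only [h2, h1]
  rw [← two_mul, L2]

/-! ### The pfaffian of the moments -/

lemma I_pow_mul_two_mul_sub_one (n : ℕ) : I ^ (n * (2 * n - 1)) = I ^ n := by
  rcases n with _ | k
  · simp
  · obtain ⟨c, hc⟩ := Nat.even_mul_succ_self k
    rw [show (k + 1) * (2 * (k + 1) - 1) = k + 1 + 4 * c by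
      rw [show 2 * (k + 1) - 1 = 2 * k + 1 by omega]; linear_combination 2 * hc]
    rw [pow_add, pow_mul, I_pow_four, one_pow, mul_one]

lemma prod_pow_div_factorial (n : ℕ) (w : ℂ) :
    (∏ j : Fin n, w ^ (2 * (j : ℕ)) / (Nat.factorial (2 * j) : ℂ)) *
      ∏ j : Fin n, w ^ (2 * (j : ℕ) + 1) / (Nat.factorial (2 * j + 1) : ℂ) =
    w ^ (n * (2 * n - 1)) / ∏ j ∈ Finset.range (2 * n), (Nat.factorial j : ℂ) := by
  have h1 : ∑ j ∈ Finset.range (2 * n), j = n * (2 * n - 1) := by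
    rw [Finset.sum_range_id, mul_assoc, Nat.mul_div_cancel_left _ two_pos]
  have h2 : (∏ s : Fin (2 * n), w ^ (s : ℕ) / (Nat.factorial s : ℂ)) =
      w ^ (n * (2 * n - 1)) / ∏ j ∈ Finset.range (2 * n), (Nat.factorial j : ℂ) := by
    rw [Fin.prod_univ_eq_prod_range (fun j => w ^ j / (Nat.factorial j : ℂ)), Finset.prod_div_distrib,
      Finset.prod_pow_eq_pow_sum, h1]
  rw [← h2, ← (pairEquiv n).prod_comp, Fintype.prod_prod_type, Fin.prod_univ_two]
  simp [pairEquiv_val]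

lemma pf_moments {p : ℂ} (hp0 : p ≠ 0) (hp : ‖p‖ < 1) (C : ℂ) (n : ℕ) :
    (-1) ^ n * pf (Matrix.of fun s t : Fin (2 * n) => ∑' k : ℤ, C * kerCoeff p k *
      (freq k ^ (s : ℕ) / (Nat.factorial s : ℂ) * ((-freq k) ^ (t : ℕ) / (Nat.factorial t : ℂ)))) =
    (2 * I * C) ^ n * (Real.pi : ℂ) ^ (n * (2 * n - 1)) /
      (∏ j ∈ Finset.range (2 * n), (Nat.factorial j : ℂ)) *
      Matrix.det (Matrix.of fun i j : Fin n => L2 p ((i : ℕ) + (j : ℕ))) := by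
  have hentry : ∀ s t : ℕ, ∑' k : ℤ, C * kerCoeff p k *
      (freq k ^ s / (Nat.factorial s : ℂ) * ((-freq k) ^ t / (Nat.factorial t : ℂ))) =
      (Real.pi * I) ^ s / (Nat.factorial s : ℂ) * ((-(Real.pi * I)) ^ t / (Nat.factorial t : ℂ)) *
        C * moment p (s + t) := by
    intro s t
    rw [moment, ← tsum_mul_left]
    refine tsum_congr fun k => ?_
    rw [show -freq k = -(Real.pi * I) * (2 * k + 1) by rw [freq, neg_mul], freq,
      mul_pow (Real.pi * I), mul_pow (-(Real.pi * I)), pow_add]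
    ring
  simp only [hentry]
  rw [pf_checkerboard (Matrix.of fun i j : Fin n =>
    ((Real.pi * I) ^ (2 * (i : ℕ)) / (Nat.factorial (2 * i) : ℂ)) *
      (((Real.pi * I) ^ (2 * (j : ℕ) + 1) / (Nat.factorial (2 * j + 1) : ℂ)) *
        ((-(2 * C)) * L2 p ((i : ℕ) + (j : ℕ)))))]
  · have hcol := Matrix.det_mul_column
      (fun i : Fin n => (Real.pi * I) ^ (2 * (i : ℕ)) / (Nat.factorial (2 * i) : ℂ))
      (Matrix.of fun i j : Fin n => ((Real.pi * I) ^ (2 * (j : ℕ) + 1) /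
        (Nat.factorial (2 * j + 1) : ℂ)) * ((-(2 * C)) * L2 p ((i : ℕ) + (j : ℕ))))
    have hrow := Matrix.det_mul_row
      (fun j : Fin n => (Real.pi * I) ^ (2 * (j : ℕ) + 1) / (Nat.factorial (2 * j + 1) : ℂ))
      (Matrix.of fun i j : Fin n => (-(2 * C)) * L2 p ((i : ℕ) + (j : ℕ)))
    have hsmul := Matrix.det_smul (Matrix.of fun i j : Fin n => L2 p ((i : ℕ) + (j : ℕ))) (-(2 * C))
    simp only [Matrix.of_apply, Fintype.card_fin] at hcol hrow hsmul
    rw [hcol, hrow, ← mul_assoc (∏ _, _), prod_pow_div_factorial]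
    refine (congrArg (fun x => (-1 : ℂ) ^ n * (_ * x)) hsmul).trans ?_
    rw [mul_pow (Real.pi : ℂ), I_pow_mul_two_mul_sub_one, neg_pow (2 * C), mul_pow (2 * I), mul_pow,
      mul_pow]
    have : ((-1 : ℂ) ^ n) * (-1) ^ n = 1 := by rw [← mul_pow]; simp
    linear_combination (2 ^ n * I ^ n * C ^ n * (Real.pi : ℂ) ^ (n * (2 * n - 1)) /
      (∏ j ∈ Finset.range (2 * n), (Nat.factorial j : ℂ)) *
      Matrix.det (Matrix.of fun i j : Fin n => L2 p ((i : ℕ) + (j : ℕ)))) * this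
  · intro i j
    simp only [Matrix.of_apply, pairEquiv_val]
    rw [moment_even hp0 hp ⟨i + j, by simp; ring⟩, mul_zero]
  · intro i j
    simp only [Matrix.of_apply, pairEquiv_val, Fin.val_zero, Fin.val_one, add_zero]
    rw [show 2 * (i : ℕ) + (2 * j + 1) = 2 * (i + j) + 1 by ring, moment_odd hp0 hp,
      (odd_two_mul_add_one (j : ℕ)).neg_pow]
    ring
  · intro i j
    simp only [Matrix.of_apply, pairEquiv_val, Fin.val_zero, Fin.val_one, add_zero]
    rw [show 2 * (i : ℕ) + 1 + 2 * j = 2 * (j + i) + 1 by ring, moment_odd hp0 hp,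
      (even_two_mul (j : ℕ)).neg_pow]
    ring
  · intro i j
    simp only [Matrix.of_apply, pairEquiv_val]
    rw [moment_even hp0 hp ⟨i + j + 1, by simp; ring⟩, mul_zero]

/-! ### The kernel as a sum of exponentials -/

lemma pPow_eq_pow (τ : ℂ) (k : ℕ) : pPow τ k = pPow τ 1 ^ k := by
  rw [pPow, pPow, ← exp_nat_mul]; congr 1; ring

lemma pPow_ne_zero (τ lam : ℂ) : pPow τ lam ≠ 0 := exp_ne_zero _

lemma norm_pPow_one_lt_one {τ : ℂ} (hτ : 0 < τ.im) : ‖pPow τ 1‖ < 1 := by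
  rw [pPow, norm_exp, Real.exp_lt_one_iff]
  simpa using mul_pos Real.pi_pos hτ

lemma theta_ne_zero {q y : ℂ} (hq : ‖q‖ < 1) (hy : ‖y‖ < 1) (hqy : ‖q‖ < ‖y‖) : theta y q ≠ 0 := by
  refine mul_ne_zero (qpoch_ne_zero hq hy) (qpoch_ne_zero hq ?_)
  rw [norm_div]
  exact (div_lt_one ((norm_nonneg _).trans_lt hqy)).2 hqy

lemma kernel_eq_tsum {p : ℂ} (hp0 : p ≠ 0) (hp : ‖p‖ < 1) {z w : ℂ}
    (h1 : ‖p‖ < ‖xOf z ^ 2 / xOf w ^ 2‖) (h2 : ‖p‖ * ‖xOf z ^ 2 / xOf w ^ 2‖ < 1) :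
    xOf w / xOf z * theta (xOf z ^ 2 / xOf w ^ 2) (p ^ 2) *
      theta (p * (xOf z ^ 2 / xOf w ^ 2)) (p ^ 2) *
      theta (-(p * (xOf z ^ 2 / xOf w ^ 2))) (p ^ 2) /
      theta (p ^ 3 * (xOf z ^ 6 / xOf w ^ 6)) (p ^ 6) =
    ∑' k : ℤ, C2 p * kerCoeff p k * (exp (freq k * z) * exp (-freq k * w)) := by
  have hz : xOf z ≠ 0 := exp_ne_zero _
  have hw : xOf w ≠ 0 := exp_ne_zero _
  have hq : ‖p ^ 6‖ < 1 := by rw [norm_pow]; exact pow_lt_one₀ (norm_nonneg _) hp (by norm_num)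
  have h6 : xOf z ^ 6 / xOf w ^ 6 = (xOf z ^ 2 / xOf w ^ 2) ^ 3 := by rw [div_pow]; ring
  have key := theta_eq_kerSeries hp0 hp h1 h2
  have hterm : ∀ k : ℤ, exp (freq k * z) * exp (-freq k * w) =
      xOf z / xOf w * (xOf z ^ 2 / xOf w ^ 2) ^ k := by
    intro k
    rw [xOf, xOf, ← exp_sub, ← div_pow, ← exp_sub, ← exp_nat_mul, ← exp_int_mul, ← exp_add, ← exp_add,
      freq]
    congr 1
    push_cast
    ring
  have hrhs : ∑' k : ℤ, C2 p * kerCoeff p k * (exp (freq k * z) * exp (-freq k * w)) =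
      C2 p * (xOf z / xOf w) * kerSeries p (xOf z ^ 2 / xOf w ^ 2) := by
    rw [kerSeries, ← tsum_mul_left]
    exact tsum_congr fun k => by rw [hterm]; ring
  have hne : theta (p ^ 3 * (xOf z ^ 2 / xOf w ^ 2) ^ 3) (p ^ 6) ≠ 0 := by
    refine theta_ne_zero hq ?_ ?_
    · rw [← mul_pow, norm_pow, norm_mul]
      exact pow_lt_one₀ (by positivity) h2 three_ne_zero
    · rw [show p ^ 6 = p ^ 3 * p ^ 3 by ring, norm_mul, norm_mul]
      refine mul_lt_mul_of_pos_left ?_ (norm_pos_iff.2 (pow_ne_zero _ hp0))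
      rw [norm_pow, norm_pow]
      exact pow_lt_pow_left₀ h1 (norm_nonneg _) three_ne_zero
  rw [hrhs, h6, div_eq_iff hne, mul_assoc, mul_assoc, key]
  field_simp

lemma P2_eq {n : ℕ} {τ : ℂ} (hτ : 0 < τ.im) {z : Fin (2 * n) → ℂ}
    (h1 : ∀ i j, ‖pPow τ 1‖ < ‖xOf (z i) ^ 2 / xOf (z j) ^ 2‖)
    (h2 : ∀ i j, ‖pPow τ 1‖ * ‖xOf (z i) ^ 2 / xOf (z j) ^ 2‖ < 1) :
    P2 n τ z = (∏ i, ∏ j, if i < j then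
        theta (pPow τ 1 ^ 3 * (xOf (z i) ^ 6 / xOf (z j) ^ 6)) (pPow τ 1 ^ 6) else 1) *
      pf (Matrix.of fun i j => ∑' k : ℤ, C2 (pPow τ 1) * kerCoeff (pPow τ 1) k *
        (exp (freq k * z i) * exp (-freq k * z j))) := by
  have e2 : pPow τ 2 = pPow τ 1 ^ 2 := mod_cast pPow_eq_pow τ 2
  have e3 : pPow τ 3 = pPow τ 1 ^ 3 := mod_cast pPow_eq_pow τ 3
  have e6 : pPow τ 6 = pPow τ 1 ^ 6 := mod_cast pPow_eq_pow τ 6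
  simp only [P2, e2, e3, e6]
  congr 2
  ext i j
  exact kernel_eq_tsum (pPow_ne_zero τ 1) (norm_pPow_one_lt_one hτ) (h1 i j) (h2 i j)

lemma continuous_xOf_ratio {N : ℕ} (m : ℕ) (i j : Fin N) :
    Continuous fun z : Fin N → ℂ => xOf (z i) ^ m / xOf (z j) ^ m := by
  have h : Continuous xOf := by unfold xOf; fun_prop
  exact ((h.comp (continuous_apply i)).pow m).div ((h.comp (continuous_apply j)).pow m)
    fun z => pow_ne_zero _ (exp_ne_zero _)

lemma tendsto_xOf_ratio {N : ℕ} (m : ℕ) (i j : Fin N) :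
    Filter.Tendsto (fun z : Fin N → ℂ => xOf (z i) ^ m / xOf (z j) ^ m) (nhds 0) (nhds 1) := by
  simpa [xOf] using (continuous_xOf_ratio m i j).tendsto 0

lemma tendsto_prod_theta {p : ℂ} (hp0 : p ≠ 0) (hp : ‖p‖ < 1) (n : ℕ) :
    Filter.Tendsto (fun z : Fin (2 * n) → ℂ => ∏ i, ∏ j, if i < j then
        theta (p ^ 3 * (xOf (z i) ^ 6 / xOf (z j) ^ 6)) (p ^ 6) else 1) (nhds 0)
      (nhds ((qpoch (p ^ 3) (p ^ 6) ^ 2) ^ (n * (2 * n - 1)))) := by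
  have hq : ‖p ^ 6‖ < 1 := by rw [norm_pow]; exact pow_lt_one₀ (norm_nonneg _) hp (by norm_num)
  have hp3 : p ^ 3 ≠ 0 := pow_ne_zero _ hp0
  have hth : theta (p ^ 3) (p ^ 6) = qpoch (p ^ 3) (p ^ 6) ^ 2 := by
    rw [theta, show p ^ 6 / p ^ 3 = p ^ 3 by field_simp, sq]
  rw [← hth, ← prod_pairs_const]
  refine tendsto_finsetProd _ fun i _ => tendsto_finsetProd _ fun j _ => ?_
  split_ifs
  · have := (tendsto_xOf_ratio 6 i j).const_mul (p ^ 3)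
    rw [mul_one] at this
    exact (continuousAt_theta hq hp3).tendsto.comp this
  · exact tendsto_const_nhds

theorem stmt16 (n : ℕ) (hn : 1 ≤ n) (τ : ℂ) (hτ : 0 < τ.im) :
    Filter.Tendsto
      (fun z : Fin (2 * n) → ℂ =>
        P2 n τ z / ∏ i, ∏ j, if i < j then z i - z j else 1)
      (nhdsWithin 0 {z : Fin (2 * n) → ℂ | Function.Injective z})
      (nhds ((2 * Complex.I * C2 (pPow τ 1)) ^ n * D2 (pPow τ 1) ^ (n * (2 * n - 1)) /
          (∏ j ∈ Finset.range (2 * n), (Nat.factorial j : ℂ)) *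
        Matrix.det (Matrix.of fun i j : Fin n => L2 (pPow τ 1) ((i : ℕ) + (j : ℕ))))) := by
  have hp0 := pPow_ne_zero τ 1
  have hp := norm_pPow_one_lt_one hτ
  obtain ⟨R, hR, hs⟩ := exists_summable_kerCoeff_exp hp0 hp
  have hs' : Summable fun k : ℤ =>
      ‖C2 (pPow τ 1) * kerCoeff (pPow τ 1) k‖ * Real.exp (2 * R * ‖freq k‖) := by
    simpa only [norm_mul, mul_assoc] using hs.mul_left ‖C2 (pPow τ 1)‖
  have hlim := ((tendsto_prod_theta hp0 hp n).mono_left nhdsWithin_le_nhds).mul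
    (tendsto_pf_expKernel hs' hR n)
  rw [pf_moments hp0 hp] at hlim
  have hnorm : ∀ i j : Fin (2 * n), Filter.Tendsto
      (fun z : Fin (2 * n) → ℂ => ‖xOf (z i) ^ 2 / xOf (z j) ^ 2‖) (nhds 0) (nhds 1) := fun i j => by
    simpa using (tendsto_xOf_ratio 2 i j).norm
  have h1 : ∀ᶠ z : Fin (2 * n) → ℂ in nhds 0, ∀ i j,
      ‖pPow τ 1‖ < ‖xOf (z i) ^ 2 / xOf (z j) ^ 2‖ :=
    Filter.eventually_all.2 fun i => Filter.eventually_all.2 fun j =>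
      (hnorm i j).eventually_const_lt hp
  have h2 : ∀ᶠ z : Fin (2 * n) → ℂ in nhds 0, ∀ i j,
      ‖pPow τ 1‖ * ‖xOf (z i) ^ 2 / xOf (z j) ^ 2‖ < 1 :=
    Filter.eventually_all.2 fun i => Filter.eventually_all.2 fun j =>
      ((hnorm i j).const_mul _).eventually_lt_const (by rwa [mul_one])
  have hval : (qpoch (pPow τ 1 ^ 3) (pPow τ 1 ^ 6) ^ 2) ^ (n * (2 * n - 1)) *
      ((2 * I * C2 (pPow τ 1)) ^ n * (Real.pi : ℂ) ^ (n * (2 * n - 1)) /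
        (∏ j ∈ Finset.range (2 * n), (Nat.factorial j : ℂ)) *
        Matrix.det (Matrix.of fun i j : Fin n => L2 (pPow τ 1) ((i : ℕ) + (j : ℕ)))) =
      (2 * I * C2 (pPow τ 1)) ^ n * D2 (pPow τ 1) ^ (n * (2 * n - 1)) /
        (∏ j ∈ Finset.range (2 * n), (Nat.factorial j : ℂ)) *
        Matrix.det (Matrix.of fun i j : Fin n => L2 (pPow τ 1) ((i : ℕ) + (j : ℕ))) := by
    rw [D2, mul_pow (Real.pi : ℂ)]
    ring
  rw [hval] at hlim
  refine hlim.congr' ?_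
  filter_upwards [nhdsWithin_le_nhds h1, nhdsWithin_le_nhds h2] with z hz1 hz2
  rw [P2_eq hτ hz1 hz2, mul_div_assoc]

end
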